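/- arXiv:1810.02177 — 2 statements merged into one kernel-verified Lean document; each statement's English description precedes it below -/
import Mathlib

section
/- Let $H \in (0, 1/2)$ and for $T > 0$ define $I_{12}(T) := \int_{[0,T]^3} e^{s_1 - T - |s_2 - t|} \, \mathrm{sgn}(s_2 - t) \, \big( t^{2H-1} + (T-t)^{2H-1} \big) \, \big( s_1^{2H-1} - \mathrm{sgn}(s_1 - s_2)|s_1 - s_2|^{2H-1} \big) \, dt \, ds_1 \, ds_2$. Then $\limsup_{T \to \infty} T^{1-2H} \, \Big| I_{12}(T) - \tfrac{1}{2} \Gamma(2H)^2 \sigma_H^2 \Big| < \infty$. -/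
open MeasureTheory Real Filter

/-- Tonelli's theorem for a nonnegative kernel whose iterated integral in one order is finite. -/
theorem integral_swap_of_nonneg {μ ν : Measure ℝ} [SFinite μ] [SFinite ν] {f : ℝ → ℝ → ℝ}
    (hf : Measurable (Function.uncurry f)) (h0 : ∀ᵐ y ∂ν, ∀ᵐ x ∂μ, 0 ≤ f x y)
    (h1 : ∀ᵐ y ∂ν, Integrable (fun x => f x y) μ)
    (h2 : Integrable (fun y => ∫ x, f x y ∂μ) ν) :
    Integrable (fun x => ∫ y, f x y ∂ν) μ ∧
      ∫ x, ∫ y, f x y ∂ν ∂μ = ∫ y, ∫ x, f x y ∂μ ∂ν := by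
  have hi : Integrable (Function.uncurry f) (μ.prod ν) := by
    rw [integrable_prod_iff' hf.aestronglyMeasurable]
    refine ⟨h1, h2.congr ?_⟩
    filter_upwards [h0] with y hy
    refine integral_congr_ae ?_
    filter_upwards [hy] with x hx
    simp [abs_of_nonneg hx]
  exact ⟨hi.integral_prod_left, integral_integral_swap hi⟩

theorem integrableOn_rpow_mul_exp_neg_mul {s r : ℝ} (hs : 0 < s) (hr : 0 < r) :
    IntegrableOn (fun x : ℝ => x ^ (s - 1) * exp (-(r * x))) (Set.Ioi 0) := by
  have := integrableOn_rpow_mul_exp_neg_mul_rpow (s := s - 1) (p := 1) (b := r)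
    (by linarith) one_pos hr
  simpa using this

theorem integrableOn_exp_neg_mul_Ioi {c : ℝ} (hc : 0 < c) (r : ℝ) :
    IntegrableOn (fun t : ℝ => exp (-(c * t))) (Set.Ioi r) := by
  simpa using integrableOn_exp_mul_Ioi (a := -c) (by linarith) r

theorem integral_exp_neg_mul_Ioi {c : ℝ} (hc : 0 < c) (r : ℝ) :
    ∫ t in Set.Ioi r, exp (-(c * t)) = exp (-(c * r)) / c := by
  have := integral_exp_mul_Ioi (a := -c) (by linarith) r
  simp only [neg_mul, neg_div_neg_eq] at this
  exact this

theorem integral_rpow_div_one_add_sq {s : ℝ} (hs : 0 < s) (hs2 : s < 2) :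
    IntegrableOn (fun x : ℝ => x ^ (s - 1) / (1 + x) ^ 2) (Set.Ioi 0) ∧
      ∫ x in Set.Ioi (0 : ℝ), x ^ (s - 1) / (1 + x) ^ 2 = Gamma s * Gamma (2 - s) := by
  have key : ∀ y ∈ Set.Ioi (0 : ℝ),
      ∫ x in Set.Ioi (0 : ℝ), x ^ (s - 1) * (y * exp (-((1 + x) * y)))
        = Gamma s * (exp (-y) * y ^ (2 - s - 1)) := by
    intro y hy
    have hy' : (0 : ℝ) < y := hy
    have : ∀ x : ℝ, x ^ (s - 1) * (y * exp (-((1 + x) * y)))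
        = (y * exp (-y)) * (x ^ (s - 1) * exp (-(y * x))) := by
      intro x
      rw [show -((1 + x) * y) = -y + -(y * x) by ring, exp_add]; ring
    simp_rw [this]
    rw [integral_const_mul, integral_rpow_mul_exp_neg_mul_Ioi hs hy', one_div,
      inv_rpow hy'.le, ← rpow_neg hy'.le, show 2 - s - 1 = 1 + -s by ring, rpow_add hy', rpow_one]
    ring
  have inner : ∀ x ∈ Set.Ioi (0 : ℝ),
      ∫ y in Set.Ioi (0 : ℝ), x ^ (s - 1) * (y * exp (-((1 + x) * y)))
        = x ^ (s - 1) / (1 + x) ^ 2 := by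
    intro x hx
    have hx' : (0 : ℝ) < 1 + x := by have : (0 : ℝ) < x := hx; linarith
    have := integral_rpow_mul_exp_neg_mul_Ioi (a := 2) two_pos hx'
    norm_num at this
    rw [integral_const_mul, this]
    field_simp
  obtain ⟨h1, h2⟩ := integral_swap_of_nonneg (μ := volume.restrict (Set.Ioi (0 : ℝ)))
    (ν := volume.restrict (Set.Ioi (0 : ℝ)))
    (f := fun x y => x ^ (s - 1) * (y * exp (-((1 + x) * y))))
    (by simp only [Function.uncurry_def]; fun_prop)
    (by
      filter_upwards [ae_restrict_mem measurableSet_Ioi] with y hy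
      filter_upwards [ae_restrict_mem measurableSet_Ioi] with x hx
      have : (0 : ℝ) < x := hx
      have : (0 : ℝ) < y := hy
      positivity)
    (by
      filter_upwards [ae_restrict_mem measurableSet_Ioi] with y hy
      refine ((integrableOn_rpow_mul_exp_neg_mul hs hy).const_mul (y * exp (-y))).congr
        (Eventually.of_forall fun x => ?_)
      simp only
      rw [show -((1 + x) * y) = -y + -(y * x) by ring, exp_add]; ring)
    (by
      refine IntegrableOn.congr_fun ?_ (fun y hy => (key y hy).symm) measurableSet_Ioi
      exact (GammaIntegral_convergent (by linarith)).const_mul _)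
  refine ⟨IntegrableOn.congr_fun h1 inner measurableSet_Ioi, ?_⟩
  rw [← setIntegral_congr_fun measurableSet_Ioi inner, h2,
    setIntegral_congr_fun measurableSet_Ioi key, integral_const_mul,
    ← Gamma_eq_integral (by linarith)]

/-- The part of `∫ exp (-|s - t|) * t ^ (a - 1) dt`, `t > 0`, that comes from `t < s`. -/
noncomputable def causal (a s : ℝ) : ℝ :=
  exp (-s) * ∫ t in (0 : ℝ)..s, exp t * t ^ (a - 1)

/-- The part of `∫ exp (-|s - t|) * t ^ (a - 1) dt`, `t > 0`, that comes from `t > s`. -/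
noncomputable def anticausal (a s : ℝ) : ℝ :=
  exp s * (Gamma a - ∫ t in (0 : ℝ)..s, exp (-t) * t ^ (a - 1))

section basic

variable {a : ℝ}

theorem intervalIntegrable_mul_rpow (ha : 0 < a) {f : ℝ → ℝ} (hf : Continuous f) (x y : ℝ) :
    IntervalIntegrable (fun t => f t * t ^ (a - 1)) volume x y :=
  (intervalIntegral.intervalIntegrable_rpow' (by linarith)).continuousOn_mul hf.continuousOn

theorem hasDerivAt_primitive_mul_rpow (ha : 0 < a) {f : ℝ → ℝ} (hf : Continuous f) {s : ℝ}
    (hs : 0 < s) :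
    HasDerivAt (fun s => ∫ t in (0 : ℝ)..s, f t * t ^ (a - 1)) (f s * s ^ (a - 1)) s :=
  intervalIntegral.integral_hasDerivAt_right (intervalIntegrable_mul_rpow ha hf _ _)
    (by
      have : Measurable fun t => f t * t ^ (a - 1) := by fun_prop
      exact this.stronglyMeasurable.stronglyMeasurableAtFilter)
    (hf.continuousAt.mul (continuousAt_rpow_const _ _ (Or.inl hs.ne')))

theorem continuous_causal (ha : 0 < a) : Continuous (causal a) :=
  (continuous_exp.comp continuous_neg).mul
    (intervalIntegral.continuous_primitive (intervalIntegrable_mul_rpow ha continuous_exp) 0)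

theorem continuous_anticausal (ha : 0 < a) : Continuous (anticausal a) :=
  continuous_exp.mul (continuous_const.sub (intervalIntegral.continuous_primitive
    (intervalIntegrable_mul_rpow ha (continuous_exp.comp continuous_neg)) 0))

theorem hasDerivAt_causal (ha : 0 < a) {s : ℝ} (hs : 0 < s) :
    HasDerivAt (causal a) (s ^ (a - 1) - causal a s) s := by
  have := ((hasDerivAt_neg s).exp).mul (hasDerivAt_primitive_mul_rpow ha continuous_exp hs)
  refine this.congr_deriv ?_
  have h : exp (-s) * exp s = 1 := by rw [← exp_add]; simp
  simp only [causal]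
  linear_combination s ^ (a - 1) * h

theorem hasDerivAt_anticausal (ha : 0 < a) {s : ℝ} (hs : 0 < s) :
    HasDerivAt (anticausal a) (anticausal a s - s ^ (a - 1)) s := by
  have := (hasDerivAt_exp s).mul ((hasDerivAt_const s (Gamma a)).sub
    (hasDerivAt_primitive_mul_rpow ha (continuous_exp.comp continuous_neg) hs))
  refine this.congr_deriv ?_
  have h : exp s * exp (-s) = 1 := by rw [← exp_add]; simp
  simp only [anticausal, Function.comp_apply, Pi.sub_apply]
  linear_combination - s ^ (a - 1) * h

theorem causal_zero : causal a 0 = 0 := by simp [causal]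

theorem anticausal_eq_integral_Ioi (ha : 0 < a) {s : ℝ} (hs : 0 ≤ s) :
    anticausal a s = exp s * ∫ t in Set.Ioi s, exp (-t) * t ^ (a - 1) := by
  rw [anticausal, Gamma_eq_integral ha,
    ← intervalIntegral.integral_Ioi_sub_Ioi (GammaIntegral_convergent ha) hs]
  ring

theorem anticausal_eq_laplace (ha : 0 < a) (ha1 : a < 1) {r : ℝ} (hr : 0 < r) :
    IntegrableOn (fun x : ℝ => x ^ (-a) * exp (-(r * x)) / (1 + x)) (Set.Ioi 0) ∧
    Gamma (1 - a) * anticausal a r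
      = ∫ x in Set.Ioi (0 : ℝ), x ^ (-a) * exp (-(r * x)) / (1 + x) := by
  have key : ∀ t ∈ Set.Ioi r,
      ∫ x in Set.Ioi (0 : ℝ), x ^ (-a) * exp (-((1 + x) * t))
        = Gamma (1 - a) * (exp (-t) * t ^ (a - 1)) := by
    intro t ht
    have ht' : (0 : ℝ) < t := hr.trans ht
    have : ∀ x : ℝ, x ^ (-a) * exp (-((1 + x) * t))
        = exp (-t) * (x ^ (1 - a - 1) * exp (-(t * x))) := by
      intro x
      rw [show -((1 + x) * t) = -t + -(t * x) by ring, exp_add,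
        show 1 - a - 1 = -a by ring]; ring
    simp_rw [this]
    rw [integral_const_mul, integral_rpow_mul_exp_neg_mul_Ioi (by linarith) ht', one_div,
      inv_rpow ht'.le, ← rpow_neg ht'.le, neg_sub]
    ring
  have inner : ∀ x ∈ Set.Ioi (0 : ℝ),
      ∫ t in Set.Ioi r, x ^ (-a) * exp (-((1 + x) * t))
        = exp (-r) * (x ^ (-a) * exp (-(r * x)) / (1 + x)) := by
    intro x hx
    have hx' : (0 : ℝ) < 1 + x := by have : (0 : ℝ) < x := hx; linarith
    rw [integral_const_mul, integral_exp_neg_mul_Ioi hx',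
      show -((1 + x) * r) = -r + -(r * x) by ring, exp_add]
    ring
  obtain ⟨h1, h2⟩ := integral_swap_of_nonneg (μ := volume.restrict (Set.Ioi (0 : ℝ)))
    (ν := volume.restrict (Set.Ioi r))
    (f := fun x t => x ^ (-a) * exp (-((1 + x) * t)))
    (by simp only [Function.uncurry_def]; fun_prop)
    (by
      filter_upwards with t
      filter_upwards [ae_restrict_mem measurableSet_Ioi] with x hx
      have : (0 : ℝ) < x := hx
      positivity)
    (by
      filter_upwards [ae_restrict_mem measurableSet_Ioi] with t ht
      refine ((integrableOn_rpow_mul_exp_neg_mul (s := 1 - a) (by linarith)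
        (hr.trans ht)).const_mul (exp (-t))).congr
        (Eventually.of_forall fun x => ?_)
      simp only
      rw [show -((1 + x) * t) = -t + -(t * x) by ring, exp_add,
        show 1 - a - 1 = -a by ring]; ring)
    (by
      refine IntegrableOn.congr_fun ?_ (fun y hy => (key y hy).symm) measurableSet_Ioi
      exact ((GammaIntegral_convergent ha).mono_set (Set.Ioi_subset_Ioi hr.le)).const_mul _)
  have hexp : exp r * exp (-r) = 1 := by rw [← exp_add]; simp
  constructor
  · refine IntegrableOn.congr_fun ((IntegrableOn.congr_fun h1 inner measurableSet_Ioi).const_mul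
      (exp r)) (fun x _ => ?_) measurableSet_Ioi
    rw [← mul_assoc, hexp, one_mul]
  · rw [setIntegral_congr_fun measurableSet_Ioi inner, setIntegral_congr_fun measurableSet_Ioi key,
      integral_const_mul, integral_const_mul] at h2
    rw [anticausal_eq_integral_Ioi ha hr.le]
    linear_combination -exp r * h2 + (∫ x in Set.Ioi (0 : ℝ), x ^ (-a) * exp (-(r * x)) / (1 + x)) * hexp

theorem rpow_sub_anticausal_eq_laplace (ha : 0 < a) (ha1 : a < 1) {r : ℝ} (hr : 0 < r) :
    IntegrableOn (fun x : ℝ => x ^ (1 - a) * exp (-(r * x)) / (1 + x)) (Set.Ioi 0) ∧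
    Gamma (1 - a) * (r ^ (a - 1) - anticausal a r)
      = ∫ x in Set.Ioi (0 : ℝ), x ^ (1 - a) * exp (-(r * x)) / (1 + x) := by
  obtain ⟨h1, h2⟩ := anticausal_eq_laplace ha ha1 hr
  have h3 := integrableOn_rpow_mul_exp_neg_mul (s := 1 - a) (r := r) (by linarith) hr
  have h4 := integral_rpow_mul_exp_neg_mul_Ioi (a := 1 - a) (r := r) (by linarith) hr
  rw [one_div, inv_rpow hr.le, ← rpow_neg hr.le, neg_sub] at h4
  have hpt : ∀ x ∈ Set.Ioi (0 : ℝ), x ^ (1 - a - 1) * exp (-(r * x))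
      - x ^ (-a) * exp (-(r * x)) / (1 + x) = x ^ (1 - a) * exp (-(r * x)) / (1 + x) := by
    intro x hx
    have hx0 : (0 : ℝ) < x := hx
    rw [show 1 - a - 1 = -a by ring, show 1 - a = 1 + -a by ring, rpow_add hx0, rpow_one]
    field_simp
    ring
  refine ⟨IntegrableOn.congr_fun (h3.sub h1) hpt measurableSet_Ioi, ?_⟩
  rw [← setIntegral_congr_fun measurableSet_Ioi hpt, integral_sub h3 h1, ← h2, h4]
  ring

theorem anticausal_nonneg (ha : 0 < a) {r : ℝ} (hr : 0 ≤ r) : 0 ≤ anticausal a r := by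
  rw [anticausal_eq_integral_Ioi ha hr]
  refine mul_nonneg (exp_pos _).le (setIntegral_nonneg measurableSet_Ioi fun t ht => ?_)
  exact mul_nonneg (exp_pos _).le (rpow_nonneg (hr.trans (le_of_lt ht)) _)

theorem anticausal_le_rpow (ha : 0 < a) (ha1 : a < 1) {r : ℝ} (hr : 0 < r) :
    anticausal a r ≤ r ^ (a - 1) := by
  have h := (rpow_sub_anticausal_eq_laplace ha ha1 hr).2
  have : 0 ≤ ∫ x in Set.Ioi (0 : ℝ), x ^ (1 - a) * exp (-(r * x)) / (1 + x) := by
    refine setIntegral_nonneg measurableSet_Ioi fun x hx => ?_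
    have : (0 : ℝ) < x := hx
    positivity
  rw [← h] at this
  have := nonneg_of_mul_nonneg_right this (Gamma_pos_of_pos (by linarith : 0 < 1 - a))
  linarith

theorem rpow_sub_anticausal_le (ha : 0 < a) (ha1 : a < 1) {r : ℝ} (hr : 0 < r) :
    r ^ (a - 1) - anticausal a r ≤ (1 - a) * r ^ (a - 2) := by
  obtain ⟨h1, h2⟩ := rpow_sub_anticausal_eq_laplace ha ha1 hr
  have h3 := integrableOn_rpow_mul_exp_neg_mul (s := 2 - a) (r := r) (by linarith) hr
  have h4 := integral_rpow_mul_exp_neg_mul_Ioi (a := 2 - a) (r := r) (by linarith) hr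
  rw [one_div, inv_rpow hr.le, ← rpow_neg hr.le, neg_sub, show 2 - a = 1 - a + 1 by ring,
    Gamma_add_one (by linarith)] at h4
  have hG := Gamma_pos_of_pos (by linarith : 0 < 1 - a)
  have hle : ∫ x in Set.Ioi (0 : ℝ), x ^ (1 - a) * exp (-(r * x)) / (1 + x)
      ≤ ∫ x in Set.Ioi (0 : ℝ), x ^ (2 - a - 1) * exp (-(r * x)) := by
    refine setIntegral_mono_on h1 h3 measurableSet_Ioi fun x hx => ?_
    have hx0 : (0 : ℝ) < x := hx
    rw [show 2 - a - 1 = 1 - a by ring]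
    exact div_le_self (by positivity) (by linarith)
  rw [show 2 - a - 1 = 1 - a + 1 - 1 by ring, h4, ← h2] at hle
  refine le_of_mul_le_mul_left ?_ hG
  linarith

end basic

section bounds

variable {a : ℝ}

theorem causal_nonneg (a : ℝ) {s : ℝ} (hs : 0 ≤ s) : 0 ≤ causal a s :=
  mul_nonneg (exp_pos _).le (intervalIntegral.integral_nonneg hs fun _ ht =>
    mul_nonneg (exp_pos _).le (rpow_nonneg ht.1 _))

theorem rpow_sub_causal_le (ha : 0 < a) (ha1 : a < 1) {s : ℝ} (hs : 0 < s) :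
    s ^ (a - 1) - causal a s ≤ s ^ (a - 2) := by
  have h1 : ∫ t in (0 : ℝ)..s, exp t * s ^ (a - 1) ≤ ∫ t in (0 : ℝ)..s, exp t * t ^ (a - 1) := by
    refine intervalIntegral.integral_mono_on_of_le_Ioo hs.le
      (Continuous.intervalIntegrable (by fun_prop) _ _)
      (intervalIntegrable_mul_rpow ha continuous_exp _ _) fun t ht => ?_
    exact mul_le_mul_of_nonneg_left
      (rpow_le_rpow_of_nonpos ht.1 ht.2.le (by linarith)) (exp_pos _).le
  rw [intervalIntegral.integral_mul_const, integral_exp, exp_zero] at h1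
  have h2 : exp (-s) * exp s = 1 := by rw [← exp_add]; simp
  have h3 : s ^ (a - 1) = s * s ^ (a - 2) := by
    rw [show a - 1 = 1 + (a - 2) by ring, rpow_add hs, rpow_one]
  have h4 : exp (-s) * s ≤ 1 := by
    have := add_one_le_exp s
    rw [← h2]
    exact mul_le_mul_of_nonneg_left (by linarith) (exp_pos _).le
  have h5 := mul_le_mul_of_nonneg_left h1 (exp_pos (-s)).le
  have h6 := mul_le_mul_of_nonneg_right h4 (rpow_nonneg hs.le (a - 2))
  have h7 : exp (-s) * ((exp s - 1) * s ^ (a - 1))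
      = s ^ (a - 1) - exp (-s) * s * s ^ (a - 2) := by
    rw [h3]; linear_combination s * s ^ (a - 2) * h2
  rw [h7] at h5
  unfold causal
  linarith

theorem exists_causal_sub_rpow_le (ha : 0 < a) (ha1 : a < 1) :
    ∃ C : ℝ, 0 ≤ C ∧ ∀ s : ℝ, 4 ≤ s → causal a s - s ^ (a - 1) ≤ C * s ^ (a - 2) := by
  set A : ℝ → ℝ := fun s => ∫ t in (0 : ℝ)..s, exp t * t ^ (a - 1) with hA
  have hA4 : 0 ≤ A 4 := intervalIntegral.integral_nonneg (by norm_num) fun t ht =>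
    mul_nonneg (exp_pos _).le (rpow_nonneg ht.1 _)
  set C : ℝ := 2 + 16 * A 4 with hC
  have hd : ∀ s : ℝ, 0 < s → HasDerivAt (fun s => exp s * (s ^ (a - 1) + C * s ^ (a - 2)) - A s)
      (exp s * s ^ (a - 3) * ((C + a - 1) * s - C * (2 - a))) s := by
    intro s hs
    have := ((hasDerivAt_exp s).mul ((hasDerivAt_rpow_const (p := a - 1) (Or.inl hs.ne')).add
      ((hasDerivAt_rpow_const (p := a - 2) (Or.inl hs.ne')).const_mul C))).sub
      (hasDerivAt_primitive_mul_rpow ha continuous_exp hs)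
    refine this.congr_deriv ?_
    have e1 : s ^ (a - 2) = s * s ^ (a - 3) := by
      rw [show a - 2 = 1 + (a - 3) by ring, rpow_add hs, rpow_one]
    rw [show a - 1 - 1 = a - 2 by ring, show a - 2 - 1 = a - 3 by ring]
    simp only [Pi.add_apply]
    rw [e1]
    ring
  have hmono : MonotoneOn (fun s => exp s * (s ^ (a - 1) + C * s ^ (a - 2)) - A s)
      (Set.Ici 4) := by
    refine monotoneOn_of_deriv_nonneg (convex_Ici 4) ?_ ?_ ?_
    · intro s hs
      exact (hd s (by have : (4 : ℝ) ≤ s := hs; linarith)).continuousAt.continuousWithinAt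
    · intro s hs
      rw [interior_Ici] at hs
      exact (hd s (by have : (4 : ℝ) < s := hs; linarith)).differentiableAt.differentiableWithinAt
    · intro s hs
      rw [interior_Ici] at hs
      have hs4 : (4 : ℝ) < s := hs
      have hs0 : 0 < s := by linarith
      rw [(hd s hs0).deriv]
      refine mul_nonneg (by positivity) ?_
      nlinarith
  refine ⟨C, by positivity, fun s hs => ?_⟩
  have h4 : (0 : ℝ) ≤ exp 4 * ((4 : ℝ) ^ (a - 1) + C * (4 : ℝ) ^ (a - 2)) - A 4 := by
    have e1 : (1 / 16 : ℝ) ≤ (4 : ℝ) ^ (a - 2) := by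
      have : (4 : ℝ) ^ (-2 : ℝ) ≤ (4 : ℝ) ^ (a - 2) :=
        rpow_le_rpow_of_exponent_le (by norm_num) (by linarith)
      refine le_trans (le_of_eq ?_) this
      rw [rpow_neg (by norm_num)]
      norm_num
    have e2 : (1 : ℝ) ≤ exp 4 := one_le_exp (by norm_num)
    have e3 : (0 : ℝ) ≤ (4 : ℝ) ^ (a - 1) := by positivity
    have e4 : A 4 ≤ (4 : ℝ) ^ (a - 1) + C * (4 : ℝ) ^ (a - 2) := by nlinarith
    nlinarith
  have h5 := h4.trans (hmono Set.self_mem_Ici hs hs)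
  have h6 : exp (-s) * exp s = 1 := by rw [← exp_add]; simp
  have h7 := mul_nonneg (exp_pos (-s)).le h5
  have h8 : causal a s = exp (-s) * A s := rfl
  have h9 : exp (-s) * (exp s * (s ^ (a - 1) + C * s ^ (a - 2)) - A s)
      = s ^ (a - 1) + C * s ^ (a - 2) - exp (-s) * A s := by
    linear_combination (s ^ (a - 1) + C * s ^ (a - 2)) * h6
  linarith

theorem exists_bound_one_add_rpow {f : ℝ → ℝ} (hf : Continuous f) {e C : ℝ} (he : e ≤ 0)
    (hC : ∀ s : ℝ, 4 ≤ s → |f s| ≤ C * s ^ e) :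
    ∃ C' : ℝ, 0 ≤ C' ∧ ∀ s : ℝ, 0 ≤ s → |f s| ≤ C' * (1 + s) ^ e := by
  have hc : ContinuousOn (fun s => |f s| * (1 + s) ^ (-e)) (Set.Icc 0 4) := by
    refine hf.abs.continuousOn.mul (ContinuousOn.rpow_const (by fun_prop) fun s hs => ?_)
    exact Or.inl (by linarith [hs.1])
  obtain ⟨M, hM⟩ := (isCompact_Icc.image_of_continuousOn hc).bddAbove
  have hC0 : 0 ≤ C := by
    have := (abs_nonneg _).trans (hC 4 le_rfl)
    exact nonneg_of_mul_nonneg_left this (by positivity)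
  refine ⟨max M (C * 2 ^ (-e)), le_max_of_le_right (by positivity), fun s hs => ?_⟩
  have hp : (0 : ℝ) < 1 + s := by linarith
  rcases le_total s 4 with h | h
  · have : |f s| * (1 + s) ^ (-e) ≤ M := hM ⟨s, ⟨hs, h⟩, rfl⟩
    rw [rpow_neg hp.le, ← div_eq_mul_inv, div_le_iff₀ (by positivity)] at this
    exact this.trans (mul_le_mul_of_nonneg_right (le_max_left _ _) (by positivity))
  · refine (hC s h).trans ((le_trans ?_ (mul_le_mul_of_nonneg_right (le_max_right M _)
      (by positivity))))
    rw [mul_assoc]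
    refine mul_le_mul_of_nonneg_left ?_ hC0
    have h1 : s ^ e ≤ ((1 + s) / 2) ^ e :=
      rpow_le_rpow_of_nonpos (by positivity) (by linarith) he
    rw [div_rpow hp.le (by norm_num)] at h1
    rw [rpow_neg (by norm_num), mul_comm, ← div_eq_mul_inv]
    exact h1

theorem exists_causal_le (ha : 0 < a) (ha1 : a < 1) :
    ∃ C : ℝ, 0 ≤ C ∧ ∀ s : ℝ, 0 ≤ s → causal a s ≤ C * (1 + s) ^ (a - 1) := by
  obtain ⟨C, hC, h⟩ := exists_causal_sub_rpow_le ha ha1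
  obtain ⟨C', hC', h'⟩ := exists_bound_one_add_rpow (continuous_causal ha) (e := a - 1)
    (C := 1 + C) (by linarith) (fun s hs => by
      have hs0 : 0 < s := by linarith
      rw [abs_of_nonneg (causal_nonneg a hs0.le)]
      have h1 : s ^ (a - 2) ≤ s ^ (a - 1) :=
        rpow_le_rpow_of_exponent_le (by linarith) (by linarith)
      nlinarith [h s hs])
  exact ⟨C', hC', fun s hs => (le_abs_self _).trans (h' s hs)⟩

theorem exists_abs_causal_sub_anticausal_le (ha : 0 < a) (ha1 : a < 1) :
    ∃ C : ℝ, 0 ≤ C ∧ ∀ s : ℝ, 0 ≤ s → |causal a s - anticausal a s| ≤ C * (1 + s) ^ (a - 2) := by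
  obtain ⟨C, hC, h⟩ := exists_causal_sub_rpow_le ha ha1
  refine exists_bound_one_add_rpow ((continuous_causal ha).sub (continuous_anticausal ha))
    (C := 1 + C) (by linarith) fun s hs => ?_
  have hs0 : 0 < s := by linarith
  have h1 := rpow_sub_causal_le ha ha1 hs0
  have h2 := h s hs
  have h3 := anticausal_le_rpow ha ha1 hs0
  have h4 := rpow_sub_anticausal_le ha ha1 hs0
  have h5 : 0 ≤ s ^ (a - 2) := by positivity
  rw [Pi.sub_apply, abs_le]
  constructor <;> nlinarith

theorem exists_anticausal_le (ha : 0 < a) (ha1 : a < 1) :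
    ∃ C : ℝ, 0 ≤ C ∧ ∀ s : ℝ, 0 ≤ s → anticausal a s ≤ C * (1 + s) ^ (a - 1) := by
  obtain ⟨C', hC', h'⟩ := exists_bound_one_add_rpow (continuous_anticausal ha) (e := a - 1)
    (C := 1) (by linarith) (fun s hs => by
      have hs0 : 0 < s := by linarith
      rw [abs_of_nonneg (anticausal_nonneg ha hs0.le), one_mul]
      exact anticausal_le_rpow ha ha1 hs0)
  exact ⟨C', hC', fun s hs => (le_abs_self _).trans (h' s hs)⟩

theorem one_add_rpow_le_one {s e : ℝ} (hs : 0 ≤ s) (he : e ≤ 0) : (1 + s) ^ e ≤ 1 :=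
  rpow_le_one_of_one_le_of_nonpos (by linarith) he

theorem laplace_causal (ha : 0 < a) (ha1 : a < 1) {x : ℝ} (hx : 0 < x) :
    IntegrableOn (fun r => causal a r * exp (-(x * r))) (Set.Ioi 0) ∧
      ∫ r in Set.Ioi (0 : ℝ), causal a r * exp (-(x * r)) = Gamma a * x ^ (-a) / (1 + x) := by
  obtain ⟨C, hC, hb⟩ := exists_causal_le ha ha1
  have hb1 : ∀ r : ℝ, 0 ≤ r → causal a r ≤ C := fun r hr =>
    (hb r hr).trans (mul_le_of_le_one_right hC (one_add_rpow_le_one hr (by linarith)))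
  have hcont : Continuous fun r => causal a r * exp (-(x * r)) :=
    (continuous_causal ha).mul (by fun_prop)
  have h1 : IntegrableOn (fun r => causal a r * exp (-(x * r))) (Set.Ioi 0) := by
    refine Integrable.mono' ((integrableOn_exp_neg_mul_Ioi hx 0).const_mul C)
      hcont.aestronglyMeasurable ?_
    filter_upwards [ae_restrict_mem measurableSet_Ioi] with r hr
    have hr' : (0 : ℝ) ≤ r := le_of_lt hr
    rw [norm_of_nonneg (mul_nonneg (causal_nonneg a hr') (exp_pos _).le)]
    exact mul_le_mul_of_nonneg_right (hb1 r hr') (exp_pos _).le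
  refine ⟨h1, ?_⟩
  have h2 := integrableOn_rpow_mul_exp_neg_mul ha hx
  have hd : ∀ r ∈ Set.Ioi (0 : ℝ), HasDerivAt (fun r => causal a r * exp (-(x * r)))
      (r ^ (a - 1) * exp (-(x * r)) - (1 + x) * (causal a r * exp (-(x * r)))) r := by
    intro r hr
    have := (hasDerivAt_causal ha hr).mul (((hasDerivAt_id r).const_mul x).neg.exp)
    refine this.congr_deriv ?_
    simp only [Pi.neg_apply, id]
    ring
  have ht : Tendsto (fun r => causal a r * exp (-(x * r))) atTop (nhds 0) := by
    have : Tendsto (fun r : ℝ => C * exp (-(x * r))) atTop (nhds 0) := by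
      have := (tendsto_exp_neg_atTop_nhds_zero.comp (tendsto_id.const_mul_atTop hx)).const_mul C
      simpa [Function.comp_def] using this
    refine squeeze_zero' ?_ ?_ this
    · filter_upwards [eventually_ge_atTop 0] with r hr
      exact mul_nonneg (causal_nonneg a hr) (exp_pos _).le
    · filter_upwards [eventually_ge_atTop 0] with r hr
      exact mul_le_mul_of_nonneg_right (hb1 r hr) (exp_pos _).le
  have h3 := integral_Ioi_of_hasDerivAt_of_tendsto (a := (0 : ℝ)) hcont.continuousWithinAt hd
    (h2.sub (h1.const_mul (1 + x))) ht
  rw [integral_sub h2 (h1.const_mul (1 + x)), integral_const_mul,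
    integral_rpow_mul_exp_neg_mul_Ioi ha hx, causal_zero, one_div, inv_rpow hx.le,
    ← rpow_neg hx.le] at h3
  have hx1 : (1 + x) ≠ 0 := by positivity
  rw [eq_div_iff hx1]
  linarith

theorem integral_causal_mul_rpow_sub_anticausal (ha : 0 < a) (ha1 : a < 1) :
    IntegrableOn (fun r => causal a r * (r ^ (a - 1) - anticausal a r)) (Set.Ioi 0) ∧
      ∫ r in Set.Ioi (0 : ℝ), causal a r * (r ^ (a - 1) - anticausal a r)
        = Gamma a * Gamma (2 - 2 * a) * Gamma (2 * a) / Gamma (1 - a) := by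
  have hG := Gamma_pos_of_pos (by linarith : 0 < 1 - a)
  obtain ⟨hB1, hB2⟩ := integral_rpow_div_one_add_sq (s := 2 - 2 * a) (by linarith) (by linarith)
  rw [sub_sub_cancel] at hB2
  have key : ∀ x ∈ Set.Ioi (0 : ℝ),
      ∫ r in Set.Ioi (0 : ℝ), causal a r * (x ^ (1 - a) * exp (-(r * x)) / (1 + x))
        = Gamma a * (x ^ (2 - 2 * a - 1) / (1 + x) ^ 2) := by
    intro x hx
    have hx0 : (0 : ℝ) < x := hx
    have : ∀ r : ℝ, causal a r * (x ^ (1 - a) * exp (-(r * x)) / (1 + x))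
        = (x ^ (1 - a) / (1 + x)) * (causal a r * exp (-(x * r))) := by
      intro r; rw [mul_comm r x]; ring
    simp_rw [this]
    rw [integral_const_mul, (laplace_causal ha ha1 hx0).2,
      show 2 - 2 * a - 1 = 1 - a + -a by ring, rpow_add hx0]
    field_simp
  have inner : ∀ r ∈ Set.Ioi (0 : ℝ),
      ∫ x in Set.Ioi (0 : ℝ), causal a r * (x ^ (1 - a) * exp (-(r * x)) / (1 + x))
        = Gamma (1 - a) * (causal a r * (r ^ (a - 1) - anticausal a r)) := by
    intro r hr
    rw [integral_const_mul, ← (rpow_sub_anticausal_eq_laplace ha ha1 hr).2]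
    ring
  obtain ⟨h1, h2⟩ := integral_swap_of_nonneg (μ := volume.restrict (Set.Ioi (0 : ℝ)))
    (ν := volume.restrict (Set.Ioi (0 : ℝ)))
    (f := fun r x => causal a r * (x ^ (1 - a) * exp (-(r * x)) / (1 + x)))
    (by
      simp only [Function.uncurry_def]
      have := (continuous_causal ha).measurable
      fun_prop)
    (by
      filter_upwards [ae_restrict_mem measurableSet_Ioi] with x hx
      filter_upwards [ae_restrict_mem measurableSet_Ioi] with r hr
      have : (0 : ℝ) < x := hx
      exact mul_nonneg (causal_nonneg a (le_of_lt hr)) (by positivity))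
    (by
      filter_upwards [ae_restrict_mem measurableSet_Ioi] with x hx
      refine ((laplace_causal ha ha1 hx).1.const_mul (x ^ (1 - a) / (1 + x))).congr
        (Eventually.of_forall fun r => ?_)
      simp only
      rw [mul_comm r x]; ring)
    (IntegrableOn.congr_fun (hB1.const_mul _) (fun x hx => (key x hx).symm) measurableSet_Ioi)
  rw [setIntegral_congr_fun measurableSet_Ioi inner, setIntegral_congr_fun measurableSet_Ioi key,
    integral_const_mul, integral_const_mul, hB2] at h2
  constructor
  · refine IntegrableOn.congr_fun ((IntegrableOn.congr_fun h1 inner measurableSet_Ioi).const_mul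
      (Gamma (1 - a))⁻¹) (fun r _ => ?_) measurableSet_Ioi
    field_simp
  · rw [eq_div_iff hG.ne']
    linarith

end bounds

section asymptotics

variable {a : ℝ}

theorem mul_exp_neg_le_rpow (ha : 0 < a) {T : ℝ} (hT : 1 ≤ T) :
    T * exp (-T) ≤ 2 * T ^ (a - 1) := by
  have hT0 : 0 < T := by linarith
  have h1 := quadratic_le_exp_of_nonneg hT0.le
  have h2 : T ^ (-1 : ℝ) ≤ T ^ (a - 1) := rpow_le_rpow_of_exponent_le hT (by linarith)
  rw [rpow_neg_one] at h2
  have h3 : T * exp (-T) ≤ 2 * T⁻¹ := by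
    rw [exp_neg, ← div_eq_mul_inv, ← div_eq_mul_inv, div_le_div_iff₀ (exp_pos _) hT0]
    nlinarith
  linarith

theorem exp_neg_le_one_add_rpow (ha : 0 < a) {r : ℝ} (hr : 0 ≤ r) :
    exp (-r) ≤ (1 + r) ^ (a - 1) := by
  have h1 : (1 + r) ^ (-1 : ℝ) ≤ (1 + r) ^ (a - 1) :=
    rpow_le_rpow_of_exponent_le (by linarith) (by linarith)
  refine le_trans ?_ h1
  rw [rpow_neg_one, exp_neg]
  exact inv_anti₀ (by linarith) (by linarith [add_one_le_exp r])

theorem one_add_rpow_le_rpow {s e : ℝ} (hs : 0 < s) (he : e ≤ 0) : (1 + s) ^ e ≤ s ^ e :=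
  rpow_le_rpow_of_nonpos hs (by linarith) he

theorem setIntegral_Ioi_rpow_sub_anticausal (ha : 0 < a) (ha1 : a < 1) {T : ℝ} (hT : 0 < T) :
    IntegrableOn (fun r => r ^ (a - 1) - anticausal a r) (Set.Ioi T) ∧
      ∫ r in Set.Ioi T, (r ^ (a - 1) - anticausal a r) = anticausal a T := by
  have hd : ∀ r ∈ Set.Ici T, HasDerivAt (fun r => -anticausal a r)
      (r ^ (a - 1) - anticausal a r) r := fun r hr =>
    ((hasDerivAt_anticausal ha (hT.trans_le hr)).neg).congr_deriv (by ring)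
  have hpos : ∀ r ∈ Set.Ioi T, 0 ≤ r ^ (a - 1) - anticausal a r := fun r hr =>
    sub_nonneg.2 (anticausal_le_rpow ha ha1 (hT.trans hr))
  have ht : Tendsto (fun r => -anticausal a r) atTop (nhds 0) := by
    rw [← neg_zero]
    refine Tendsto.neg ?_
    have := tendsto_rpow_neg_atTop (y := 1 - a) (by linarith)
    rw [neg_sub] at this
    refine squeeze_zero' ?_ ?_ this
    · filter_upwards [eventually_ge_atTop 0] with r hr using anticausal_nonneg ha hr
    · filter_upwards [eventually_gt_atTop 0] with r hr using anticausal_le_rpow ha ha1 hr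
  refine ⟨integrableOn_Ioi_deriv_of_nonneg' hd hpos ht, ?_⟩
  rw [integral_Ioi_of_hasDerivAt_of_nonneg' hd hpos ht]
  ring

theorem integral_causal_sub_anticausal_mul_causal (ha : 0 < a) {T : ℝ} (hT : 0 ≤ T) :
    ∫ r in (0 : ℝ)..T, (causal a r - anticausal a r) * causal a r
      = -(causal a T ^ 2) / 2
        + ∫ r in (0 : ℝ)..T, causal a r * (r ^ (a - 1) - anticausal a r) := by
  have hp := continuous_causal ha
  have hq := continuous_anticausal ha
  have hi1 : IntervalIntegrable (fun r => causal a r ^ 2 - causal a r * r ^ (a - 1))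
      volume 0 T :=
    ((hp.pow 2).intervalIntegrable _ _).sub (intervalIntegrable_mul_rpow ha hp _ _)
  have hi2 : IntervalIntegrable (fun r => causal a r * (r ^ (a - 1) - anticausal a r))
      volume 0 T := by
    simp_rw [mul_sub]
    exact (intervalIntegrable_mul_rpow ha hp _ _).sub ((hp.mul hq).intervalIntegrable _ _)
  have h := intervalIntegral.integral_eq_sub_of_hasDerivAt_of_le hT
    (f := fun r => -(causal a r ^ 2) / 2)
    (((hp.pow 2).neg.div_const 2).continuousOn) (fun r hr => by
      have := (((hasDerivAt_causal ha hr.1).pow 2).neg.div_const 2)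
      exact this.congr_deriv (by push_cast; ring)) hi1
  have h0 : -(causal a T ^ 2) / 2
      = ∫ r in (0 : ℝ)..T, (causal a r ^ 2 - causal a r * r ^ (a - 1)) := by
    rw [h, causal_zero]; ring
  rw [h0, ← intervalIntegral.integral_add hi1 hi2]
  congr 1 with r
  ring

theorem integral_causal_sub_anticausal_mul_exp_neg (ha : 0 < a) {T : ℝ} (hT : 0 ≤ T) :
    ∫ r in (0 : ℝ)..T, (causal a r - anticausal a r) * exp (-r)
      = (1 / 2 - a) * Gamma a + exp (-T) *
        (T ^ a - causal a T / 2 - T * anticausal a T + (a - 1 / 2) * anticausal a T) := by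
  have hp := continuous_causal ha
  have hq := continuous_anticausal ha
  have hi1 : IntervalIntegrable (fun r => (causal a r - anticausal a r) * exp (-r))
      volume 0 T := Continuous.intervalIntegrable ((hp.sub hq).mul (by fun_prop)) _ _
  have hi2 : IntervalIntegrable (fun r => exp (-r) * r ^ (a - 1)) volume 0 T :=
    intervalIntegrable_mul_rpow ha (by fun_prop) _ _
  have h := intervalIntegral.integral_eq_sub_of_hasDerivAt_of_le hT
    (f := fun r => exp (-r) * (r ^ a - causal a r / 2 - r * anticausal a r))
    (f' := fun r => (causal a r - anticausal a r) * exp (-r)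
      + (a - 1 / 2) * (exp (-r) * r ^ (a - 1)))
    (Continuous.continuousOn (by
      have := continuous_rpow_const ha.le
      fun_prop)) (fun r hr => by
      have := ((hasDerivAt_neg r).exp).mul (((hasDerivAt_rpow_const (p := a)
        (Or.inl hr.1.ne')).sub ((hasDerivAt_causal ha hr.1).div_const 2)).sub
        ((hasDerivAt_id r).mul (hasDerivAt_anticausal ha hr.1)))
      refine this.congr_deriv ?_
      have e1 : r ^ a = r * r ^ (a - 1) := by
        conv_lhs => rw [show a = 1 + (a - 1) by ring]
        rw [rpow_add hr.1, rpow_one]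
      simp only [Pi.sub_apply, Pi.mul_apply, id]
      rw [e1]
      ring) (hi1.add (hi2.const_mul _))
  rw [intervalIntegral.integral_add hi1 (hi2.const_mul _), intervalIntegral.integral_const_mul,
    causal_zero, zero_rpow ha.ne'] at h
  have h2 : ∫ r in (0 : ℝ)..T, exp (-r) * r ^ (a - 1) = Gamma a - exp (-T) * anticausal a T := by
    have : exp (-T) * exp T = 1 := by rw [← exp_add]; simp
    rw [anticausal, ← mul_assoc, this]
    ring
  rw [h2] at h
  linear_combination h

theorem exists_abs_integral_mul_causal_sub_le (ha : 0 < a) (ha1 : a < 1) :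
    ∃ C : ℝ, ∀ T : ℝ, 1 ≤ T →
      |(∫ r in (0 : ℝ)..T, (causal a r - anticausal a r) * causal a r)
        - Gamma a * Gamma (2 - 2 * a) * Gamma (2 * a) / Gamma (1 - a)| ≤ C * T ^ (a - 1) := by
  obtain ⟨C, hC, hp⟩ := exists_causal_le ha ha1
  obtain ⟨hK1, hK2⟩ := integral_causal_mul_rpow_sub_anticausal ha ha1
  have hp1 : ∀ r : ℝ, 0 ≤ r → causal a r ≤ C := fun r hr =>
    (hp r hr).trans (mul_le_of_le_one_right hC (one_add_rpow_le_one hr (by linarith)))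
  refine ⟨C ^ 2 + C, fun T hT => ?_⟩
  have hT0 : 0 < T := by linarith
  obtain ⟨hQ1, hQ2⟩ := setIntegral_Ioi_rpow_sub_anticausal ha ha1 hT0
  have hq := anticausal_le_rpow ha ha1 hT0
  have hpos : ∀ r ∈ Set.Ioi T, 0 ≤ r ^ (a - 1) - anticausal a r := fun r hr =>
    sub_nonneg.2 (anticausal_le_rpow ha ha1 (hT0.trans hr))
  have htail0 : 0 ≤ ∫ r in Set.Ioi T, causal a r * (r ^ (a - 1) - anticausal a r) :=
    setIntegral_nonneg measurableSet_Ioi fun r hr =>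
      mul_nonneg (causal_nonneg a (hT0.trans hr).le) (hpos r hr)
  have htail : ∫ r in Set.Ioi T, causal a r * (r ^ (a - 1) - anticausal a r)
      ≤ C * T ^ (a - 1) := by
    calc _ ≤ ∫ r in Set.Ioi T, C * (r ^ (a - 1) - anticausal a r) :=
          setIntegral_mono_on (hK1.mono_set (Set.Ioi_subset_Ioi hT0.le)) (hQ1.const_mul C)
            measurableSet_Ioi fun r hr =>
              mul_le_mul_of_nonneg_right (hp1 r (hT0.trans hr).le) (hpos r hr)
      _ = C * anticausal a T := by rw [integral_const_mul, hQ2]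
      _ ≤ _ := mul_le_mul_of_nonneg_left hq hC
  have hpT : causal a T ^ 2 ≤ C ^ 2 * T ^ (a - 1) := by
    have h1 : causal a T ≤ C * T ^ (a - 1) := (hp T hT0.le).trans
      (mul_le_mul_of_nonneg_left (one_add_rpow_le_rpow hT0 (by linarith)) hC)
    have h2 := hp1 T hT0.le
    have h3 := causal_nonneg a hT0.le
    calc causal a T ^ 2 = causal a T * causal a T := sq _
      _ ≤ C * (C * T ^ (a - 1)) := mul_le_mul h2 h1 h3 hC
      _ = _ := by ring
  rw [integral_causal_sub_anticausal_mul_causal ha hT0.le, ← hK2,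
    ← intervalIntegral.integral_Ioi_sub_Ioi hK1 hT0.le, abs_le]
  have hsq := sq_nonneg (causal a T)
  have : 0 ≤ C * T ^ (a - 1) := by positivity
  constructor <;> linarith

theorem exists_abs_integral_mul_exp_neg_sub_le (ha : 0 < a) (ha1 : a < 1) :
    ∃ C : ℝ, ∀ T : ℝ, 1 ≤ T →
      |(∫ r in (0 : ℝ)..T, (causal a r - anticausal a r) * exp (-r))
        - (1 / 2 - a) * Gamma a| ≤ C * T ^ (a - 1) := by
  obtain ⟨C, hC, hp⟩ := exists_causal_le ha ha1
  refine ⟨2 * (1 + C + 1 + 1), fun T hT => ?_⟩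
  have hT0 : 0 < T := by linarith
  have hp0 := causal_nonneg a hT0.le
  have hp1 : causal a T ≤ C * T := (hp T hT0.le).trans (mul_le_mul_of_nonneg_left
    ((one_add_rpow_le_one hT0.le (by linarith)).trans hT) hC)
  have hq0 := anticausal_nonneg ha hT0.le
  have hq1 : anticausal a T ≤ 1 := (anticausal_le_rpow ha ha1 hT0).trans
    (rpow_le_one_of_one_le_of_nonpos hT (by linarith))
  have hTa : T ^ a ≤ T := by
    conv_rhs => rw [← rpow_one T]
    exact rpow_le_rpow_of_exponent_le hT ha1.le
  have hTa0 : 0 ≤ T ^ a := by positivity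
  rw [integral_causal_sub_anticausal_mul_exp_neg ha hT0.le, add_sub_cancel_left, abs_mul,
    abs_of_pos (exp_pos _)]
  have habs : |T ^ a - causal a T / 2 - T * anticausal a T + (a - 1 / 2) * anticausal a T|
      ≤ (1 + C + 1 + 1) * T := by
    have h1 : T * anticausal a T ≤ T := mul_le_of_le_one_right hT0.le hq1
    have h2 : 0 ≤ T * anticausal a T := by positivity
    rw [abs_le]
    constructor <;> nlinarith
  calc _ ≤ exp (-T) * ((1 + C + 1 + 1) * T) :=
        mul_le_mul_of_nonneg_left habs (exp_pos _).le
    _ = (1 + C + 1 + 1) * (T * exp (-T)) := by ring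
    _ ≤ (1 + C + 1 + 1) * (2 * T ^ (a - 1)) :=
        mul_le_mul_of_nonneg_left (mul_exp_neg_le_rpow ha hT) (by linarith)
    _ = _ := by ring

theorem one_add_rpow_mul_one_add_rpow_le (ha : 0 < a) (ha1 : a < 1) {T r : ℝ} (hT : 0 < T)
    (hr : 0 ≤ r) (hrT : r ≤ T) :
    (1 + (T - r)) ^ (a - 2) * (1 + r) ^ (a - 1)
      ≤ 2 * T ^ (a - 1) * (1 + (T - r)) ^ (a - 2) + 4 * T ^ (a - 2) := by
  have half : ∀ e : ℝ, (T / 2) ^ e = 2 ^ (-e) * T ^ e := by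
    intro e
    rw [div_rpow hT.le two_pos.le, rpow_neg two_pos.le, mul_comm, div_eq_mul_inv]
  have hu : 0 ≤ (1 + (T - r)) ^ (a - 2) := rpow_nonneg (by linarith) _
  rcases le_total (T / 2) r with h | h
  · have h1 : (1 + r) ^ (a - 1) ≤ (T / 2) ^ (a - 1) :=
      rpow_le_rpow_of_nonpos (by positivity) (by linarith) (by linarith)
    have h2 : (2 : ℝ) ^ (-(a - 1)) ≤ 2 ^ (1 : ℝ) :=
      rpow_le_rpow_of_exponent_le (by norm_num) (by linarith)
    rw [rpow_one] at h2
    rw [half] at h1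
    have h3 : (1 + r) ^ (a - 1) ≤ 2 * T ^ (a - 1) :=
      h1.trans (mul_le_mul_of_nonneg_right h2 (by positivity))
    have h4 : 0 ≤ 4 * T ^ (a - 2) := by positivity
    nlinarith
  · have h1 : (1 + (T - r)) ^ (a - 2) ≤ (T / 2) ^ (a - 2) :=
      rpow_le_rpow_of_nonpos (by positivity) (by linarith) (by linarith)
    have h2 : (2 : ℝ) ^ (-(a - 2)) ≤ 2 ^ (2 : ℝ) :=
      rpow_le_rpow_of_exponent_le (by norm_num) (by linarith)
    norm_num at h2
    rw [half, neg_sub] at h1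
    have h3 : (1 + (T - r)) ^ (a - 2) ≤ 4 * T ^ (a - 2) :=
      h1.trans (mul_le_mul_of_nonneg_right h2 (by positivity))
    have h4 : (1 + (T - r)) ^ (a - 2) * (1 + r) ^ (a - 1) ≤ (1 + (T - r)) ^ (a - 2) :=
      mul_le_of_le_one_right hu (one_add_rpow_le_one hr (by linarith))
    have h5 : 0 ≤ 2 * T ^ (a - 1) * (1 + (T - r)) ^ (a - 2) := by positivity
    linarith

theorem integral_one_add_sub_rpow_le (ha1 : a < 1) {T : ℝ} (hT : 0 ≤ T) :
    ∫ r in (0 : ℝ)..T, (1 + (T - r)) ^ (a - 2) ≤ 1 / (1 - a) := by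
  rw [intervalIntegral.integral_comp_sub_left (fun x => (1 + x) ^ (a - 2)) T,
    intervalIntegral.integral_comp_add_left (fun x => x ^ (a - 2)) 1,
    integral_rpow (Or.inr ⟨by linarith, by
      rw [Set.uIcc_of_le (by linarith)]
      intro h
      linarith [h.1]⟩)]
  simp only [sub_self, sub_zero, add_zero, one_rpow]
  rw [show a - 2 + 1 = -(1 - a) by ring, div_neg, ← neg_div, neg_sub]
  refine div_le_div_of_nonneg_right ?_ (by linarith)
  have : 0 ≤ (1 + T) ^ (-(1 - a)) := rpow_nonneg (by linarith) _
  linarith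

theorem exists_abs_remainder_le (ha : 0 < a) (ha1 : a < 1) :
    ∃ C : ℝ, ∀ T : ℝ, 1 ≤ T →
      |∫ r in (0 : ℝ)..T, ((causal a r - anticausal a r) * (exp (-T) * anticausal a (T - r))
        + (-(causal a (T - r) - anticausal a (T - r))
            + anticausal a T * (exp (r - T) - exp (-r)))
          * (causal a r - Gamma a * exp (-r) + exp (-T) * anticausal a (T - r)))|
        ≤ C * T ^ (a - 1) := by
  obtain ⟨P, hP, hp⟩ := exists_causal_le ha ha1
  obtain ⟨Q, hQ, hq⟩ := exists_anticausal_le ha ha1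
  obtain ⟨D, hD, hg⟩ := exists_abs_causal_sub_anticausal_le ha ha1
  have hG := Gamma_pos_of_pos ha
  set E : ℝ := P + Gamma a + Q with hE
  have hE0 : 0 ≤ E := by positivity
  refine ⟨2 * (D * Q) + D * E * (2 * (1 / (1 - a)) + 4) + 2 * E, fun T hT => ?_⟩
  have hT0 : 0 < T := by linarith
  have hTa : 0 ≤ T ^ (a - 1) := by positivity
  have hu : IntervalIntegrable (fun r => (1 + (T - r)) ^ (a - 2)) volume 0 T := by
    refine ContinuousOn.intervalIntegrable (ContinuousOn.rpow_const (by fun_prop) ?_)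
    intro r hr
    rw [Set.uIcc_of_le hT0.le] at hr
    exact Or.inl (by linarith [hr.2])
  have he : IntervalIntegrable (fun r => exp (r - T) + exp (-r)) volume 0 T :=
    Continuous.intervalIntegrable (by fun_prop) _ _
  have hw : IntervalIntegrable (fun r => D * Q * exp (-T)
      + D * E * (2 * T ^ (a - 1) * (1 + (T - r)) ^ (a - 2) + 4 * T ^ (a - 2))
      + E * T ^ (a - 1) * (exp (r - T) + exp (-r))) volume 0 T :=
    (intervalIntegrable_const.add (((hu.const_mul _).add intervalIntegrable_const).const_mul _)).add
      (he.const_mul _)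
  rw [← norm_eq_abs]
  refine (intervalIntegral.norm_integral_le_of_norm_le hT0.le (.of_forall fun r hr => ?_) hw).trans
    ?_
  · have hr0 : 0 ≤ r := hr.1.le
    have hs0 : 0 ≤ T - r := by linarith [hr.2]
    have g1 : |causal a r - anticausal a r| ≤ D := (hg r hr0).trans
      (mul_le_of_le_one_right hD (one_add_rpow_le_one hr0 (by linarith)))
    have q1 : anticausal a (T - r) ≤ Q := (hq _ hs0).trans
      (mul_le_of_le_one_right hQ (one_add_rpow_le_one hs0 (by linarith)))
    have q0 := anticausal_nonneg ha hs0
    have h1 : |causal a r - Gamma a * exp (-r) + exp (-T) * anticausal a (T - r)|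
        ≤ E * (1 + r) ^ (a - 1) := by
      have e1 := exp_neg_le_one_add_rpow ha hr0
      have e2 : exp (-T) ≤ exp (-r) := exp_le_exp.2 (by linarith)
      have e3 : exp (-T) * anticausal a (T - r) ≤ (1 + r) ^ (a - 1) * Q :=
        mul_le_mul (e2.trans e1) q1 q0 (by positivity)
      have e4 : 0 ≤ exp (-T) * anticausal a (T - r) := by positivity
      have e5 : Gamma a * exp (-r) ≤ Gamma a * (1 + r) ^ (a - 1) :=
        mul_le_mul_of_nonneg_left e1 hG.le
      have e6 : 0 ≤ Gamma a * exp (-r) := by positivity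
      have e7 := hp r hr0
      have e8 := causal_nonneg a hr0
      have e9 : 0 ≤ (1 + r) ^ (a - 1) := by positivity
      have e10 : 0 ≤ P * (1 + r) ^ (a - 1) := by positivity
      have e11 : 0 ≤ Q * (1 + r) ^ (a - 1) := by positivity
      rw [hE, abs_le]
      constructor <;> linarith
    have h2 : |causal a r - Gamma a * exp (-r) + exp (-T) * anticausal a (T - r)| ≤ E :=
      h1.trans (mul_le_of_le_one_right hE0 (one_add_rpow_le_one hr0 (by linarith)))
    have h3 := hg _ hs0
    have h4 : |anticausal a T * (exp (r - T) - exp (-r))|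
        ≤ T ^ (a - 1) * (exp (r - T) + exp (-r)) := by
      rw [abs_mul, abs_of_nonneg (anticausal_nonneg ha hT0.le)]
      refine mul_le_mul (anticausal_le_rpow ha ha1 hT0) ?_ (abs_nonneg _) hTa
      have := exp_pos (r - T)
      have := exp_pos (-r)
      rw [abs_le]
      constructor <;> linarith
    have t1 : |(causal a r - anticausal a r) * (exp (-T) * anticausal a (T - r))|
        ≤ D * Q * exp (-T) := by
      rw [abs_mul, abs_of_nonneg (by positivity : 0 ≤ exp (-T) * anticausal a (T - r)),
        mul_assoc D, mul_comm Q]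
      exact mul_le_mul g1 (mul_le_mul_of_nonneg_left q1 (exp_pos _).le) (by positivity) hD
    have t2 : |causal a (T - r) - anticausal a (T - r)|
        * |causal a r - Gamma a * exp (-r) + exp (-T) * anticausal a (T - r)|
        ≤ D * E * (2 * T ^ (a - 1) * (1 + (T - r)) ^ (a - 2) + 4 * T ^ (a - 2)) := by
      refine (mul_le_mul h3 h1 (abs_nonneg _) (by positivity)).trans ?_
      rw [mul_mul_mul_comm]
      exact mul_le_mul_of_nonneg_left
        (one_add_rpow_mul_one_add_rpow_le ha ha1 hT0 hr0 hr.2) (by positivity)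
    have t3 : |anticausal a T * (exp (r - T) - exp (-r))|
        * |causal a r - Gamma a * exp (-r) + exp (-T) * anticausal a (T - r)|
        ≤ E * T ^ (a - 1) * (exp (r - T) + exp (-r)) :=
      (mul_le_mul h4 h2 (abs_nonneg _) (by positivity)).trans (le_of_eq (by ring))
    rw [norm_eq_abs]
    refine (abs_add_le _ _).trans ?_
    rw [add_assoc]
    refine add_le_add t1 ?_
    rw [abs_mul]
    refine (mul_le_mul_of_nonneg_right (abs_add_le _ _) (abs_nonneg _)).trans ?_
    rw [add_mul, abs_neg]
    exact add_le_add t2 t3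
  · have hexp : ∫ r in (0 : ℝ)..T, (exp (r - T) + exp (-r)) = 2 * (1 - exp (-T)) := by
      rw [intervalIntegral.integral_add (Continuous.intervalIntegrable (by fun_prop) _ _)
          (Continuous.intervalIntegrable (by fun_prop) _ _),
        intervalIntegral.integral_comp_sub_right (fun x => exp x) T,
        intervalIntegral.integral_comp_neg (fun x => exp x), integral_exp, integral_exp]
      simp only [sub_self, zero_sub, neg_zero, exp_zero]
      ring
    rw [intervalIntegral.integral_add (intervalIntegrable_const.add
        (((hu.const_mul _).add intervalIntegrable_const).const_mul _)) (he.const_mul _),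
      intervalIntegral.integral_add intervalIntegrable_const
        (((hu.const_mul _).add intervalIntegrable_const).const_mul _),
      intervalIntegral.integral_const_mul, intervalIntegral.integral_const_mul,
      intervalIntegral.integral_const_mul,
      intervalIntegral.integral_add (hu.const_mul _) intervalIntegrable_const,
      intervalIntegral.integral_const_mul, intervalIntegral.integral_const,
      intervalIntegral.integral_const, hexp]
    simp only [smul_eq_mul, sub_zero]
    have i1 := integral_one_add_sub_rpow_le ha1 hT0.le
    have i2 := mul_exp_neg_le_rpow ha hT
    have i3 : T * (4 * T ^ (a - 2)) = 4 * T ^ (a - 1) := by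
      rw [show a - 1 = 1 + (a - 2) by ring, rpow_add hT0, rpow_one]; ring
    rw [i3]
    have j1 : D * Q * (T * exp (-T)) ≤ 2 * (D * Q) * T ^ (a - 1) := by
      have := mul_le_mul_of_nonneg_left i2 (by positivity : 0 ≤ D * Q)
      linarith
    have j2 : D * E * (2 * T ^ (a - 1) * (∫ r in (0 : ℝ)..T, (1 + (T - r)) ^ (a - 2))
        + 4 * T ^ (a - 1)) ≤ D * E * (2 * (1 / (1 - a)) + 4) * T ^ (a - 1) := by
      rw [mul_assoc (D * E)]
      refine mul_le_mul_of_nonneg_left ?_ (by positivity)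
      have := mul_le_mul_of_nonneg_left i1 (by positivity : 0 ≤ 2 * T ^ (a - 1))
      linarith
    have j3 : E * T ^ (a - 1) * (2 * (1 - exp (-T))) ≤ 2 * E * T ^ (a - 1) := by
      have h1 := exp_pos (-T)
      have h2 : 0 ≤ E * T ^ (a - 1) := by positivity
      nlinarith
    linarith

theorem exists_abs_integral_sub_le (ha : 0 < a) (ha1 : a < 1) :
    ∃ C : ℝ, ∀ T : ℝ, 1 ≤ T →
      |(∫ r in (0 : ℝ)..T, (causal a r - anticausal a r
            - (causal a (T - r) - anticausal a (T - r))
            + anticausal a T * (exp (r - T) - exp (-r)))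
          * (causal a r - Gamma a * exp (-r) + exp (-T) * anticausal a (T - r)))
        - (Gamma a * Gamma (2 - 2 * a) * Gamma (2 * a) / Gamma (1 - a)
          - Gamma a * ((1 / 2 - a) * Gamma a))| ≤ C * T ^ (a - 1) := by
  obtain ⟨C₁, h₁⟩ := exists_abs_integral_mul_causal_sub_le ha ha1
  obtain ⟨C₂, h₂⟩ := exists_abs_integral_mul_exp_neg_sub_le ha ha1
  obtain ⟨C₃, h₃⟩ := exists_abs_remainder_le ha ha1
  refine ⟨C₁ + Gamma a * C₂ + C₃, fun T hT => ?_⟩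
  have hp := continuous_causal ha
  have hq := continuous_anticausal ha
  have hsplit : (∫ r in (0 : ℝ)..T, (causal a r - anticausal a r
            - (causal a (T - r) - anticausal a (T - r))
            + anticausal a T * (exp (r - T) - exp (-r)))
          * (causal a r - Gamma a * exp (-r) + exp (-T) * anticausal a (T - r)))
      = (∫ r in (0 : ℝ)..T, (causal a r - anticausal a r) * causal a r)
        - Gamma a * (∫ r in (0 : ℝ)..T, (causal a r - anticausal a r) * exp (-r))
        + ∫ r in (0 : ℝ)..T, ((causal a r - anticausal a r) * (exp (-T) * anticausal a (T - r))
        + (-(causal a (T - r) - anticausal a (T - r))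
            + anticausal a T * (exp (r - T) - exp (-r)))
          * (causal a r - Gamma a * exp (-r) + exp (-T) * anticausal a (T - r))) := by
    rw [← intervalIntegral.integral_const_mul, ← intervalIntegral.integral_sub,
      ← intervalIntegral.integral_add]
    · congr 1 with r
      ring
    all_goals exact Continuous.intervalIntegrable (by fun_prop) _ _
  have hG := Gamma_pos_of_pos ha
  have k₁ := abs_le.1 (h₁ T hT)
  have k₂ := abs_le.1 (h₂ T hT)
  have k₃ := abs_le.1 (h₃ T hT)
  have l₁ := mul_le_mul_of_nonneg_left k₂.1 hG.le
  have l₂ := mul_le_mul_of_nonneg_left k₂.2 hG.le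
  rw [hsplit, abs_le]
  constructor <;> linarith [k₁.1, k₁.2, k₃.1, k₃.2]

end asymptotics

section reduction

variable {a : ℝ}

theorem integral_eq_add_of_eqOn_Ioo {f f₁ f₂ : ℝ → ℝ} {x y z : ℝ} (hxy : x ≤ y) (hyz : y ≤ z)
    (h₁ : IntervalIntegrable f₁ volume x y) (h₂ : IntervalIntegrable f₂ volume y z)
    (e₁ : Set.EqOn f₁ f (Set.Ioo x y)) (e₂ : Set.EqOn f₂ f (Set.Ioo y z)) :
    IntervalIntegrable f volume x z ∧
      ∫ t in x..z, f t = (∫ t in x..y, f₁ t) + ∫ t in y..z, f₂ t := by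
  have i₁ : IntervalIntegrable f volume x y :=
    h₁.congr_uIoo (by rwa [Set.uIoo_of_le hxy])
  have i₂ : IntervalIntegrable f volume y z :=
    h₂.congr_uIoo (by rwa [Set.uIoo_of_le hyz])
  refine ⟨i₁.trans i₂, ?_⟩
  rw [← intervalIntegral.integral_add_adjacent_intervals i₁ i₂,
    intervalIntegral.integral_congr_Ioo_of_le hxy e₁,
    intervalIntegral.integral_congr_Ioo_of_le hyz e₂]

theorem integral_exp_neg_mul_rpow_eq (a T : ℝ) :
    ∫ t in (0 : ℝ)..T, exp (-t) * t ^ (a - 1) = Gamma a - exp (-T) * anticausal a T := by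
  have : exp (-T) * exp T = 1 := by rw [← exp_add]; simp
  rw [anticausal, ← mul_assoc, this]
  ring

theorem integral_exp_mul_rpow_eq (a T : ℝ) :
    ∫ t in (0 : ℝ)..T, exp t * t ^ (a - 1) = exp T * causal a T := by
  have : exp T * exp (-T) = 1 := by rw [← exp_add]; simp
  rw [causal, ← mul_assoc, this, one_mul]

theorem integral_exp_neg_abs_mul_sign_mul_rpow (ha : 0 < a) {s T : ℝ} (hs : 0 ≤ s) (hsT : s ≤ T) :
    IntervalIntegrable (fun t => exp (-|s - t|) * Real.sign (s - t) * t ^ (a - 1)) volume 0 T ∧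
    ∫ t in (0 : ℝ)..T, exp (-|s - t|) * Real.sign (s - t) * t ^ (a - 1)
      = causal a s - anticausal a s + exp (s - T) * anticausal a T := by
  have i₁ := intervalIntegrable_mul_rpow ha continuous_exp 0 s
  have i₂ : ∀ x y, IntervalIntegrable (fun t => exp (-t) * t ^ (a - 1)) volume x y :=
    intervalIntegrable_mul_rpow ha (by fun_prop)
  obtain ⟨h₁, h₂⟩ := integral_eq_add_of_eqOn_Ioo hs hsT
    (f := fun t => exp (-|s - t|) * Real.sign (s - t) * t ^ (a - 1))
    (i₁.const_mul (exp (-s))) ((i₂ s T).const_mul (-exp s))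
    (fun t ht => by
      have h : 0 < s - t := by linarith [ht.2]
      simp only
      rw [abs_of_pos h, sign_of_pos h, neg_sub, sub_eq_add_neg t s, exp_add]
      ring)
    (fun t ht => by
      have h : s - t < 0 := by linarith [ht.1]
      simp only
      rw [abs_of_neg h, sign_of_neg h, neg_neg, sub_eq_add_neg s t, exp_add]
      ring)
  refine ⟨h₁, ?_⟩
  have h₃ := intervalIntegral.integral_interval_sub_left (i₂ 0 T) (i₂ 0 s)
  rw [integral_exp_neg_mul_rpow_eq, integral_exp_neg_mul_rpow_eq] at h₃
  have h₄ : exp s * exp (-s) = 1 := by rw [← exp_add]; simp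
  rw [h₂, intervalIntegral.integral_const_mul, intervalIntegral.integral_const_mul, ← h₃,
    integral_exp_mul_rpow_eq, sub_eq_add_neg s T, exp_add]
  linear_combination (causal a s - anticausal a s) * h₄

theorem integral_exp_neg_abs_mul_sign_mul_rpow_add (ha : 0 < a) {s T : ℝ} (hs : 0 ≤ s)
    (hsT : s ≤ T) :
    ∫ t in (0 : ℝ)..T, exp (-|s - t|) * Real.sign (s - t) * (t ^ (a - 1) + (T - t) ^ (a - 1))
      = causal a s - anticausal a s - (causal a (T - s) - anticausal a (T - s))
            + anticausal a T * (exp (s - T) - exp (-s)) := by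
  obtain ⟨h₁, h₂⟩ := integral_exp_neg_abs_mul_sign_mul_rpow ha hs hsT
  obtain ⟨h₃, h₄⟩ := integral_exp_neg_abs_mul_sign_mul_rpow ha
    (by linarith : 0 ≤ T - s) (by linarith : T - s ≤ T)
  have e : ∀ t, exp (-|T - s - (T - t)|) * Real.sign (T - s - (T - t)) * (T - t) ^ (a - 1)
      = -(exp (-|s - t|) * Real.sign (s - t) * (T - t) ^ (a - 1)) := by
    intro t
    rw [show T - s - (T - t) = -(s - t) by ring, abs_neg, sign_neg]
    ring
  have h₅ : IntervalIntegrable (fun t => exp (-|s - t|) * Real.sign (s - t) * (T - t) ^ (a - 1))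
      volume 0 T := by
    have := (h₃.comp_sub_left T).symm
    rw [sub_zero, sub_self] at this
    simp_rw [e] at this
    exact this.neg.congr_uIoo (fun t _ => by simp)
  have h₆ : ∫ t in (0 : ℝ)..T, exp (-|s - t|) * Real.sign (s - t) * (T - t) ^ (a - 1)
      = -(causal a (T - s) - anticausal a (T - s) + exp (T - s - T) * anticausal a T) := by
    have := intervalIntegral.integral_comp_sub_left (a := 0) (b := T)
      (fun t => exp (-|T - s - t|) * Real.sign (T - s - t) * t ^ (a - 1)) T
    simp only [e, sub_self, sub_zero] at this
    rw [← h₄, ← this, intervalIntegral.integral_neg, neg_neg]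
  simp_rw [mul_add]
  rw [intervalIntegral.integral_add h₁ h₅, h₂, h₆, show T - s - T = -s by ring]
  ring

theorem intervalIntegrable_sign_mul_abs_rpow (ha : 0 < a) (x y : ℝ) :
    IntervalIntegrable (fun u => Real.sign u * |u| ^ (a - 1)) volume x y := by
  refine intervalIntegrable_of_odd (fun u => ?_) (fun z hz => ?_)
  · rw [sign_neg, abs_neg]; ring
  · refine (intervalIntegral.intervalIntegrable_rpow' (r := a - 1) (by linarith)).congr_uIoo ?_
    rw [Set.uIoo_of_le hz.le]
    intro u hu
    simp only
    rw [sign_of_pos hu.1, abs_of_pos hu.1, one_mul]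

theorem integral_exp_sub_mul_sign_mul_abs_rpow (ha : 0 < a) {s T : ℝ} (hs : 0 ≤ s) (hsT : s ≤ T) :
    ∫ u in (0 : ℝ)..T, exp (u - T) * (Real.sign (u - s) * |u - s| ^ (a - 1))
      = causal a (T - s) - Gamma a * exp (-(T - s)) + exp (-T) * anticausal a s := by
  have i₁ : IntervalIntegrable (fun u => exp (-u) * u ^ (a - 1)) volume 0 s :=
    intervalIntegrable_mul_rpow ha (by fun_prop) _ _
  have i₂ := intervalIntegrable_mul_rpow ha continuous_exp 0 (T - s)
  have j₁ := (i₁.comp_sub_left s).symm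
  have j₂ := i₂.comp_sub_right s
  rw [sub_self, sub_zero] at j₁
  rw [zero_add, sub_add_cancel] at j₂
  obtain ⟨-, h⟩ := integral_eq_add_of_eqOn_Ioo hs hsT
    (f := fun u => exp (u - T) * (Real.sign (u - s) * |u - s| ^ (a - 1)))
    (j₁.const_mul (-exp (s - T))) (j₂.const_mul (exp (s - T)))
    (fun u hu => by
      have h : u - s < 0 := by linarith [hu.2]
      simp only
      rw [abs_of_neg h, sign_of_neg h, show u - T = s - T + -(s - u) by ring, exp_add, neg_sub]
      ring_nf)
    (fun u hu => by
      have h : 0 < u - s := by linarith [hu.1]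
      simp only
      rw [abs_of_pos h, sign_of_pos h, show u - T = s - T + (u - s) by ring, exp_add]
      ring)
  rw [h, intervalIntegral.integral_const_mul, intervalIntegral.integral_const_mul,
    intervalIntegral.integral_comp_sub_left (fun u => exp (-u) * u ^ (a - 1)),
    intervalIntegral.integral_comp_sub_right (fun u => exp u * u ^ (a - 1)), sub_self, sub_zero,
    integral_exp_neg_mul_rpow_eq, integral_exp_mul_rpow_eq]
  have e₁ : exp (s - T) * exp (-s) = exp (-T) := by rw [← exp_add]; congr 1; ring
  have e₂ : exp (s - T) * exp (T - s) = 1 := by rw [← exp_add]; simp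
  rw [neg_sub]
  linear_combination anticausal a s * e₁ + causal a (T - s) * e₂

theorem integrableOn_mul_comp_sub {f w : ℝ → ℝ} {T : ℝ} (hf : Continuous f)
    (hw : IntervalIntegrable w volume (-T) T) :
    IntegrableOn (fun z : ℝ × ℝ => f z.2 * w (z.1 - z.2)) (Set.Ioc 0 T ×ˢ Set.Ioc 0 T) := by
  rcases lt_or_ge T 0 with hT | hT
  · rw [Set.Ioc_eq_empty (by linarith), Set.empty_prod]
    exact integrableOn_empty
  have hf' : Integrable ((Set.Icc 0 T).indicator f) :=
    (hf.continuousOn.integrableOn_compact isCompact_Icc).integrable_indicator measurableSet_Icc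
  have hw' : Integrable ((Set.Icc (-T) T).indicator w) :=
    ((intervalIntegrable_iff_integrableOn_Icc_of_le (by linarith)).1 hw).integrable_indicator
      measurableSet_Icc
  have h := (Integrable.convolution_integrand (ContinuousLinearMap.mul ℝ ℝ) hf' hw').integrableOn
    (s := Set.Ioc 0 T ×ˢ Set.Ioc 0 T)
  refine IntegrableOn.congr_fun h (fun z hz => ?_) (measurableSet_Ioc.prod measurableSet_Ioc)
  obtain ⟨⟨h₁, h₂⟩, h₃, h₄⟩ := hz
  have m₁ : z.2 ∈ Set.Icc 0 T := ⟨h₃.le, h₄⟩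
  have m₂ : z.1 - z.2 ∈ Set.Icc (-T) T := ⟨by linarith, by linarith⟩
  simp [Set.indicator_of_mem m₁, Set.indicator_of_mem m₂]

theorem integral_triple_eq (ha : 0 < a) {T : ℝ} (hT : 0 ≤ T) :
    (∫ s₁ in (0 : ℝ)..T, ∫ s₂ in (0 : ℝ)..T, ∫ t in (0 : ℝ)..T,
      exp (s₁ - T - |s₂ - t|) * Real.sign (s₂ - t) * (t ^ (a - 1) + (T - t) ^ (a - 1)) *
        (s₁ ^ (a - 1) - Real.sign (s₁ - s₂) * |s₁ - s₂| ^ (a - 1)))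
      = ∫ r in (0 : ℝ)..T, (causal a r - anticausal a r
            - (causal a (T - r) - anticausal a (T - r))
            + anticausal a T * (exp (r - T) - exp (-r)))
          * (causal a r - Gamma a * exp (-r) + exp (-T) * anticausal a (T - r)) := by
  have hp := continuous_causal ha
  have hq := continuous_anticausal ha
  set G : ℝ → ℝ := fun r => causal a r - anticausal a r
            - (causal a (T - r) - anticausal a (T - r))
            + anticausal a T * (exp (r - T) - exp (-r)) with hG
  set w : ℝ → ℝ := fun u => Real.sign u * |u| ^ (a - 1) with hw
  have hGc : Continuous G := by fun_prop
  have hanti : ∀ r, G (T - r) = -G r := by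
    intro r
    simp only [hG]
    rw [sub_sub_cancel, neg_sub, show T - r - T = -r by ring]
    ring
  have hG0 : ∫ r in (0 : ℝ)..T, G r = 0 := by
    have h := intervalIntegral.integral_comp_sub_left (a := 0) (b := T) G T
    simp only [hanti, sub_self, sub_zero, intervalIntegral.integral_neg] at h
    linarith
  have hwi := intervalIntegrable_sign_mul_abs_rpow ha
  have inner : ∀ s₁, ∀ s₂ ∈ Set.uIcc 0 T, (∫ t in (0 : ℝ)..T,
      exp (s₁ - T - |s₂ - t|) * Real.sign (s₂ - t) * (t ^ (a - 1) + (T - t) ^ (a - 1)) *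
        (s₁ ^ (a - 1) - Real.sign (s₁ - s₂) * |s₁ - s₂| ^ (a - 1)))
      = exp (s₁ - T) * s₁ ^ (a - 1) * G s₂ - exp (s₁ - T) * (G s₂ * w (s₁ - s₂)) := by
    intro s₁ s₂ hs₂
    rw [Set.uIcc_of_le hT] at hs₂
    have e : ∀ t, exp (s₁ - T - |s₂ - t|) * Real.sign (s₂ - t)
          * (t ^ (a - 1) + (T - t) ^ (a - 1)) *
          (s₁ ^ (a - 1) - Real.sign (s₁ - s₂) * |s₁ - s₂| ^ (a - 1))
        = (exp (s₁ - T) * (s₁ ^ (a - 1) - w (s₁ - s₂))) *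
          (exp (-|s₂ - t|) * Real.sign (s₂ - t) * (t ^ (a - 1) + (T - t) ^ (a - 1))) := by
      intro t
      rw [sub_eq_add_neg (s₁ - T) |s₂ - t|, exp_add]
      ring
    simp_rw [e]
    rw [intervalIntegral.integral_const_mul,
      integral_exp_neg_abs_mul_sign_mul_rpow_add ha hs₂.1 hs₂.2]
    ring
  have middle : ∀ s₁, (∫ s₂ in (0 : ℝ)..T, ∫ t in (0 : ℝ)..T,
      exp (s₁ - T - |s₂ - t|) * Real.sign (s₂ - t) * (t ^ (a - 1) + (T - t) ^ (a - 1)) *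
        (s₁ ^ (a - 1) - Real.sign (s₁ - s₂) * |s₁ - s₂| ^ (a - 1)))
      = -∫ s₂ in (0 : ℝ)..T, exp (s₁ - T) * (G s₂ * w (s₁ - s₂)) := by
    intro s₁
    have hi : IntervalIntegrable (fun s₂ => exp (s₁ - T) * (G s₂ * w (s₁ - s₂))) volume 0 T := by
      have := (hwi (s₁ - 0) (s₁ - T)).comp_sub_left s₁
      rw [sub_sub_cancel, sub_sub_cancel] at this
      exact (this.continuousOn_mul hGc.continuousOn).const_mul _
    rw [intervalIntegral.integral_congr (inner s₁), intervalIntegral.integral_sub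
      ((hGc.intervalIntegrable _ _).const_mul _) hi, intervalIntegral.integral_const_mul, hG0,
      mul_zero, zero_sub]
  simp_rw [middle]
  have hprod : IntegrableOn (Function.uncurry fun s₁ s₂ => exp (s₁ - T) * (G s₂ * w (s₁ - s₂)))
      (Set.uIoc 0 T ×ˢ Set.uIoc 0 T) := by
    rw [Set.uIoc_of_le hT]
    have := integrableOn_mul_comp_sub (f := G) (w := w) (T := T) hGc (hwi _ _)
    refine Integrable.bdd_mul (c := 1) this (Continuous.aestronglyMeasurable (by fun_prop)) ?_
    filter_upwards [ae_restrict_mem (measurableSet_Ioc.prod measurableSet_Ioc)] with z hz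
    rw [norm_of_nonneg (exp_pos _).le]
    exact exp_le_one_iff.2 (by linarith [hz.1.2])
  rw [intervalIntegral.integral_neg, intervalIntegral_intervalIntegral_swap hprod,
    ← intervalIntegral.integral_neg]
  have outer : ∀ s ∈ Set.uIcc 0 T, -(∫ u in (0 : ℝ)..T, exp (u - T) * (G s * w (u - s)))
      = G (T - s) * (causal a (T - s) - Gamma a * exp (-(T - s))
        + exp (-T) * anticausal a (T - (T - s))) := by
    intro s hs
    rw [Set.uIcc_of_le hT] at hs
    have e : ∀ u, exp (u - T) * (G s * w (u - s)) = G s * (exp (u - T) * w (u - s)) :=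
      fun u => by ring
    simp_rw [e]
    rw [intervalIntegral.integral_const_mul, integral_exp_sub_mul_sign_mul_abs_rpow ha hs.1 hs.2,
      hanti, sub_sub_cancel]
    ring
  rw [intervalIntegral.integral_congr outer, intervalIntegral.integral_comp_sub_left
    (fun r => G r * (causal a r - Gamma a * exp (-r) + exp (-T) * anticausal a (T - r))) T,
    sub_self, sub_zero]

end reduction

theorem stmt_10 (H : ℝ) (hH : H ∈ Set.Ioo (0:ℝ) (1/2))
    (σsq : ℝ)
    (hσ : σsq = (4 * H - 1) + 2 * Real.Gamma (2 - 4 * H) * Real.Gamma (4 * H) /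
        (Real.Gamma (2 * H) * Real.Gamma (1 - 2 * H)))
    (I12 : ℝ → ℝ)
    (hI12 : ∀ T : ℝ, I12 T =
      ∫ s1 in (0:ℝ)..T, ∫ s2 in (0:ℝ)..T, ∫ t in (0:ℝ)..T,
        Real.exp (s1 - T - |s2 - t|) * Real.sign (s2 - t) *
          (t ^ (2 * H - 1) + (T - t) ^ (2 * H - 1)) *
          (s1 ^ (2 * H - 1) - Real.sign (s1 - s2) * |s1 - s2| ^ (2 * H - 1))) :
    ∃ C : ℝ, ∀ᶠ T : ℝ in atTop,
      T ^ (1 - 2 * H) * |I12 T - Real.Gamma (2 * H) ^ 2 * σsq / 2| ≤ C := by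
  obtain ⟨hH0, hH1⟩ := hH
  have ha : 0 < 2 * H := by linarith
  have ha1 : 2 * H < 1 := by linarith
  have hG := Gamma_pos_of_pos ha
  have hG1 := Gamma_pos_of_pos (by linarith : 0 < 1 - 2 * H)
  obtain ⟨C, hC⟩ := exists_abs_integral_sub_le ha ha1
  refine ⟨C, ?_⟩
  filter_upwards [eventually_ge_atTop 1] with T hT
  have hT0 : 0 < T := by linarith
  have hconst : Gamma (2 * H) ^ 2 * σsq / 2
      = Gamma (2 * H) * Gamma (2 - 2 * (2 * H)) * Gamma (2 * (2 * H)) / Gamma (1 - 2 * H)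
          - Gamma (2 * H) * ((1 / 2 - 2 * H) * Gamma (2 * H)) := by
    rw [hσ, show 2 * (2 * H) = 4 * H by ring]
    field_simp
    ring
  have h := hC T hT
  rw [← integral_triple_eq ha hT0.le, ← hI12, ← hconst] at h
  calc _ ≤ T ^ (1 - 2 * H) * (C * T ^ (2 * H - 1)) :=
        mul_le_mul_of_nonneg_left h (by positivity)
    _ = C * (T ^ (1 - 2 * H) * T ^ (2 * H - 1)) := by ring
    _ = C := by rw [← rpow_add hT0]; simp
end

section
/- Let $H \in (0, 1/2)$. For $T > 0$ and $x, u \in [0,T]$ define $\varphi_5(x,u) := \int_x^T \big( \mathrm{sgn}(x+u-t)|x+u-t|^{2H-1} (T-t)^{2H-1} - \mathrm{sgn}(u-t)|u-t|^{2H-1} (T-t+x)^{2H-1} \big) dt$. Then $\limsup_{T \to \infty} T^{1-2H} \int_{[0,T]^2} e^{-u-x} |\varphi_5(x,u)| \, dx \, du < \infty$. -/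
open MeasureTheory Real Filter

theorem measurable_realSign : Measurable Real.sign := by
  unfold Real.sign
  exact Measurable.ite measurableSet_Iio measurable_const
    (Measurable.ite measurableSet_Ioi measurable_const measurable_const)

theorem abs_realSign_le_one (r : ℝ) : |Real.sign r| ≤ 1 := by
  rcases Real.sign_apply_eq r with h | h | h <;> simp [h]

theorem abs_rpow_le_abs_rpow {a r s : ℝ} (ha : a < 0) (hr : r ≠ 0) (h : |r| ≤ |s|) :
    |s| ^ a ≤ |r| ^ a :=
  rpow_le_rpow_of_nonpos (abs_pos.mpr hr) h ha.le

theorem intervalIntegrable_abs_sub_rpow {a : ℝ} (ha : -1 < a) (c p q : ℝ) :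
    IntervalIntegrable (fun t => |c - t| ^ a) volume p q := by
  have h : IntervalIntegrable (fun t : ℝ => |t| ^ a) volume (c - p) (c - q) := by
    refine intervalIntegrable_of_even (fun x => by simp) (fun x hx => ?_)
    refine (intervalIntegral.intervalIntegrable_rpow' (a := 0) (b := x) ha).congr fun t ht => ?_
    rw [Set.uIoc_of_le hx.le] at ht
    simp only [abs_of_pos ht.1]
  simpa using h.comp_sub_left c

theorem integral_abs_sub_rpow_of_le_right {a c p q : ℝ} (ha : -1 < a) (hpq : p ≤ q) (hq : q ≤ c) :
    ∫ t in p..q, |c - t| ^ a = ((c - p) ^ (a + 1) - (c - q) ^ (a + 1)) / (a + 1) := by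
  rw [← integral_rpow (Or.inl ha), ← intervalIntegral.integral_comp_sub_left (fun t => t ^ a)]
  refine intervalIntegral.integral_congr fun t ht => ?_
  rw [Set.uIcc_of_le hpq] at ht
  simp only [abs_of_nonneg (show 0 ≤ c - t by linarith [ht.2])]

theorem integral_abs_sub_rpow_of_le_left {a c p q : ℝ} (ha : -1 < a) (hpq : p ≤ q) (hp : c ≤ p) :
    ∫ t in p..q, |c - t| ^ a = ((q - c) ^ (a + 1) - (p - c) ^ (a + 1)) / (a + 1) := by
  rw [← integral_rpow (Or.inl ha), ← intervalIntegral.integral_comp_sub_right (fun t => t ^ a)]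
  refine intervalIntegral.integral_congr fun t ht => ?_
  rw [Set.uIcc_of_le hpq] at ht
  simp only [abs_sub_comm c t, abs_of_nonneg (show 0 ≤ t - c by linarith [ht.1])]

theorem integral_abs_sub_rpow_le {a p q : ℝ} (ha : -1 < a) (ha' : a < 0) (hpq : p ≤ q) (c : ℝ) :
    ∫ t in p..q, |c - t| ^ a ≤ 2 / (a + 1) * (q - p) ^ (a + 1) := by
  have hb : 0 < a + 1 := by linarith
  have inner : ∀ c, p ≤ c → c ≤ q →
      ∫ t in p..q, |c - t| ^ a ≤ 2 / (a + 1) * (q - p) ^ (a + 1) := by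
    intro c hpc hcq
    rw [← intervalIntegral.integral_add_adjacent_intervals
        (intervalIntegrable_abs_sub_rpow ha c p c) (intervalIntegrable_abs_sub_rpow ha c c q),
      integral_abs_sub_rpow_of_le_right ha hpc le_rfl,
      integral_abs_sub_rpow_of_le_left ha hcq le_rfl, sub_self, zero_rpow hb.ne', sub_zero,
      sub_zero, ← add_div, div_mul_eq_mul_div]
    have h1 : (c - p) ^ (a + 1) ≤ (q - p) ^ (a + 1) :=
      rpow_le_rpow (by linarith) (by linarith) hb.le
    have h2 : (q - c) ^ (a + 1) ≤ (q - p) ^ (a + 1) :=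
      rpow_le_rpow (by linarith) (by linarith) hb.le
    gcongr
    linarith
  have clamp : ∀ d, (∀ t ∈ Set.Ioo p q, d - t ≠ 0 ∧ |d - t| ≤ |c - t|) →
      ∫ t in p..q, |c - t| ^ a ≤ ∫ t in p..q, |d - t| ^ a := fun d hd =>
    intervalIntegral.integral_mono_on_of_le_Ioo hpq (intervalIntegrable_abs_sub_rpow ha c p q)
      (intervalIntegrable_abs_sub_rpow ha d p q)
      fun t ht => abs_rpow_le_abs_rpow ha' (hd t ht).1 (hd t ht).2
  rcases le_total c p with h | h
  · refine (clamp p fun t ht => ⟨by linarith [ht.1], ?_⟩).trans (inner p le_rfl hpq)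
    rw [abs_of_nonpos (by linarith [ht.1]), abs_of_nonpos (by linarith [ht.1])]
    linarith
  rcases le_total q c with hqc | hqc
  · refine (clamp q fun t ht => ⟨by linarith [ht.2], ?_⟩).trans (inner q hpq le_rfl)
    rw [abs_of_nonneg (by linarith [ht.2]), abs_of_nonneg (by linarith [ht.2])]
    linarith
  exact inner c h hqc

/-- The product of two power singularities is dominated by their sum. -/
theorem abs_rpow_mul_abs_rpow_le {a c d : ℝ} (ha : a < 0) (hcd : c ≠ d) (t : ℝ) :
    |c - t| ^ a * |d - t| ^ a ≤ |(c - d) / 2| ^ a * (|c - t| ^ a + |d - t| ^ a) := by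
  have hne : (c - d) / 2 ≠ 0 := div_ne_zero (sub_ne_zero.mpr hcd) two_ne_zero
  have h1 : 0 ≤ |c - t| ^ a := by positivity
  have h2 : 0 ≤ |d - t| ^ a := by positivity
  have htri : |c - d| ≤ |c - t| + |d - t| := by
    simpa [abs_sub_comm t d] using abs_sub_le c t d
  have hhalf : |(c - d) / 2| = |c - d| / 2 := by rw [abs_div, abs_two]
  rcases le_total |(c - d) / 2| |c - t| with h | h
  · have h3 := abs_rpow_le_abs_rpow ha hne h
    nlinarith [abs_nonneg ((c - d) / 2), rpow_nonneg (abs_nonneg ((c - d) / 2)) a]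
  · have h3 := abs_rpow_le_abs_rpow ha hne (s := d - t) (by linarith)
    nlinarith [abs_nonneg ((c - d) / 2), rpow_nonneg (abs_nonneg ((c - d) / 2)) a]

/-- The product of the odd power kernel at `c` and the even power kernel at `d`. -/
noncomputable def signedKernel (a c d t : ℝ) : ℝ :=
  Real.sign (c - t) * |c - t| ^ a * |d - t| ^ a

theorem abs_signedKernel_le (a c d t : ℝ) :
    |signedKernel a c d t| ≤ |c - t| ^ a * |d - t| ^ a := by
  rw [signedKernel, abs_mul, abs_mul, abs_of_nonneg (by positivity : 0 ≤ |c - t| ^ a),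
    abs_of_nonneg (by positivity : 0 ≤ |d - t| ^ a)]
  gcongr
  exact mul_le_of_le_one_left (by positivity) (abs_realSign_le_one _)

theorem abs_signedKernel_sub_le (a c d e t : ℝ) :
    |signedKernel a c d t - signedKernel a c e t| ≤
      |c - t| ^ a * |(|d - t| ^ a - |e - t| ^ a)| := by
  rw [signedKernel, signedKernel, ← mul_sub, abs_mul, abs_mul,
    abs_of_nonneg (by positivity : 0 ≤ |c - t| ^ a)]
  gcongr
  exact mul_le_of_le_one_left (by positivity) (abs_realSign_le_one _)

theorem intervalIntegrable_signedKernel {a c d : ℝ} (ha : -1 < a) (ha' : a < 0) (hcd : c ≠ d)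
    (p q : ℝ) : IntervalIntegrable (signedKernel a c d) volume p q := by
  refine (((intervalIntegrable_abs_sub_rpow ha c p q).add
    (intervalIntegrable_abs_sub_rpow ha d p q)).const_mul (|(c - d) / 2| ^ a)).mono_fun' ?_ ?_
  · have h := measurable_realSign
    unfold signedKernel
    exact Measurable.aestronglyMeasurable (by fun_prop)
  · exact Eventually.of_forall fun t =>
      (abs_signedKernel_le a c d t).trans (abs_rpow_mul_abs_rpow_le ha' hcd t)

theorem integral_kernel_bound_le {a p q : ℝ} (ha : -1 < a) (ha' : a < 0) (hpq : p ≤ q)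
    (c d k : ℝ) (hk : 0 ≤ k) :
    ∫ t in p..q, k * (|c - t| ^ a + |d - t| ^ a) ≤ k * (4 / (a + 1) * (q - p) ^ (a + 1)) := by
  rw [intervalIntegral.integral_const_mul, intervalIntegral.integral_add
    (intervalIntegrable_abs_sub_rpow ha c p q) (intervalIntegrable_abs_sub_rpow ha d p q)]
  gcongr
  have h1 := integral_abs_sub_rpow_le ha ha' hpq c
  have h2 := integral_abs_sub_rpow_le ha ha' hpq d
  have : 4 / (a + 1) = 2 / (a + 1) + 2 / (a + 1) := by ring
  rw [this, add_mul]
  linarith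

theorem abs_integral_signedKernel_le {a c d p q : ℝ} (ha : -1 < a) (ha' : a < 0) (hpq : p ≤ q)
    (hcd : c ≠ d) :
    |∫ t in p..q, signedKernel a c d t| ≤
      |(c - d) / 2| ^ a * (4 / (a + 1) * (q - p) ^ (a + 1)) := by
  rw [← Real.norm_eq_abs]
  refine (intervalIntegral.norm_integral_le_of_norm_le hpq
    (Eventually.of_forall fun t _ =>
      (abs_signedKernel_le a c d t).trans (abs_rpow_mul_abs_rpow_le ha' hcd t))
    (((intervalIntegrable_abs_sub_rpow ha c p q).add
      (intervalIntegrable_abs_sub_rpow ha d p q)).const_mul _)).trans ?_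
  exact integral_kernel_bound_le ha ha' hpq c d _ (by positivity)

theorem rpow_le_one_add_of_le_one {x b : ℝ} (hx : 0 ≤ x) (hb : 0 ≤ b) (hb' : b ≤ 1) :
    x ^ b ≤ 1 + x := by
  rcases le_total x 1 with h | h
  · linarith [rpow_le_one hx h hb]
  · have := rpow_le_rpow_of_exponent_le h hb'
    rw [rpow_one] at this
    linarith

theorem rpow_sub_rpow_add_le {a p y : ℝ} (ha : -1 ≤ a) (hp : 0 < p) (hy : 0 ≤ y) :
    p ^ a - (p + y) ^ a ≤ p ^ a * (y / p) := by
  have hz : 0 ≤ y / p := by positivity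
  have h1 : (p + y) ^ a = p ^ a * (1 + y / p) ^ a := by
    rw [← mul_rpow hp.le (by positivity)]
    congr 1
    field_simp
  have h2 : 1 - y / p ≤ (1 + y / p) ^ a := by
    refine le_trans ?_ (rpow_le_rpow_of_exponent_le (by linarith : (1:ℝ) ≤ 1 + y / p) ha)
    rw [rpow_neg_one, inv_eq_one_div, le_div_iff₀ (by positivity)]
    nlinarith
  rw [h1]
  nlinarith [rpow_pos_of_pos hp a]

theorem integral_le_of_abs_le_mul_abs_sub_rpow {f : ℝ → ℝ} {a c p q k : ℝ} (ha : -1 < a)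
    (ha' : a < 0) (hpq : p ≤ q) (hk : 0 ≤ k)
    (h : ∀ t ∈ Set.Ioc p q, |f t| ≤ k * |c - t| ^ a) :
    |∫ t in p..q, f t| ≤ k * (2 / (a + 1) * (q - p) ^ (a + 1)) := by
  rw [← Real.norm_eq_abs]
  refine (intervalIntegral.norm_integral_le_of_norm_le hpq (Eventually.of_forall h)
    ((intervalIntegrable_abs_sub_rpow ha c p q).const_mul k)).trans ?_
  rw [intervalIntegral.integral_const_mul]
  gcongr
  exact integral_abs_sub_rpow_le ha ha' hpq c

section Interior

variable {a T x u : ℝ}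

theorem abs_integral_signedKernel_left_le (ha : -1 < a) (ha' : a < 0) (hT : 4 ≤ T) (hx : 0 ≤ x)
    (hxT : x ≤ T / 4) :
    |∫ t in 0..x, signedKernel a u (T - x) t| ≤ (T / 4) ^ a * (2 / (a + 1) * (1 + x)) := by
  have hb : 0 < a + 1 := by linarith
  refine (integral_le_of_abs_le_mul_abs_sub_rpow (k := (T / 4) ^ a) (c := u) ha ha' hx
    (by positivity) fun t ht => ?_).trans ?_
  · refine (abs_signedKernel_le _ _ _ _).trans ?_
    rw [mul_comm]
    refine mul_le_mul_of_nonneg_right ?_ (by positivity)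
    exact rpow_le_rpow_of_nonpos (by linarith) (by rw [abs_of_nonneg] <;> linarith [ht.2]) ha'.le
  · rw [sub_zero]
    gcongr
    exact rpow_le_one_add_of_le_one hx hb.le (by linarith)

theorem abs_integral_signedKernel_right_le (ha : -1 < a) (ha' : a < 0) (hT : 4 ≤ T) (hx : 0 ≤ x)
    (hxT : x ≤ T / 4) (huT : u ≤ T / 4) :
    |∫ t in (T - x)..T, signedKernel a u (T + x) t| ≤ (T / 4) ^ a * (2 / (a + 1) * (1 + x)) := by
  have hb : 0 < a + 1 := by linarith
  refine (integral_le_of_abs_le_mul_abs_sub_rpow (k := (T / 4) ^ a) (c := T + x) ha ha'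
    (by linarith) (by positivity) fun t ht => ?_).trans ?_
  · refine (abs_signedKernel_le _ _ _ _).trans ?_
    refine mul_le_mul_of_nonneg_right ?_ (by positivity)
    exact rpow_le_rpow_of_nonpos (by linarith) (by rw [abs_of_nonpos] <;> linarith [ht.1]) ha'.le
  · rw [sub_sub_cancel]
    gcongr
    exact rpow_le_one_add_of_le_one hx hb.le (by linarith)

theorem abs_integral_signedKernel_sub_near_le (ha : -1 < a) (ha' : a < 0) (hT : 4 ≤ T)
    (hx : 0 ≤ x) (hxT : x ≤ T / 4) :
    |∫ t in x..(T / 2), (signedKernel a u (T - x) t - signedKernel a u (T + x) t)| ≤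
      (T / 4) ^ a * (2 / (a + 1) * (8 * x)) := by
  have hb : 0 < a + 1 := by linarith
  refine (integral_le_of_abs_le_mul_abs_sub_rpow (k := (T / 4) ^ a * (8 * x / T)) (c := u) ha ha'
    (by linarith) (by positivity) fun t ht => ?_).trans ?_
  · refine (abs_signedKernel_sub_le _ _ _ _ _).trans ?_
    rw [mul_comm]
    gcongr
    have hp : T / 4 ≤ T - x - t := by linarith [ht.2]
    have hp0 : 0 < T - x - t := by linarith
    have hs : T + x - t = T - x - t + 2 * x := by ring
    rw [abs_of_pos hp0, hs, abs_of_pos (by linarith : 0 < T - x - t + 2 * x), abs_of_nonneg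
      (sub_nonneg.mpr (rpow_le_rpow_of_nonpos hp0 (by linarith) ha'.le))]
    refine (rpow_sub_rpow_add_le ha.le hp0 (by linarith)).trans ?_
    have h1 : (T - x - t) ^ a ≤ (T / 4) ^ a :=
      rpow_le_rpow_of_nonpos (by linarith) hp ha'.le
    have h2 : 2 * x / (T - x - t) ≤ 8 * x / T := by
      rw [div_le_div_iff₀ hp0 (by linarith)]
      nlinarith
    gcongr
  · have h1 : (T / 2 - x) ^ (a + 1) ≤ T := by
      calc (T / 2 - x) ^ (a + 1) ≤ T ^ (a + 1) :=
            rpow_le_rpow (by linarith) (by linarith) hb.le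
        _ ≤ T ^ (1 : ℝ) := rpow_le_rpow_of_exponent_le (by linarith) (by linarith)
        _ = T := rpow_one T
    calc _ ≤ (T / 4) ^ a * (8 * x / T) * (2 / (a + 1) * T) := by gcongr
      _ = _ := by field_simp

theorem abs_integral_signedKernel_sub_far_le (ha : -1 < a) (ha' : a < 0) (hT : 4 ≤ T)
    (hx : 0 ≤ x) (hxT : x ≤ T / 4) (huT : u ≤ T / 4) :
    |∫ t in (T / 2)..(T - x), (signedKernel a u (T - x) t - signedKernel a u (T + x) t)| ≤
      (T / 4) ^ a * (2 / (a + 1) * (1 + x)) := by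
  have hb : 0 < a + 1 := by linarith
  rw [← Real.norm_eq_abs]
  have hi := (intervalIntegrable_abs_sub_rpow ha (T - x) (T / 2) (T - x)).sub
    (intervalIntegrable_abs_sub_rpow ha (T + x) (T / 2) (T - x))
  refine (intervalIntegral.norm_integral_le_of_norm_le
    (g := fun t => (T / 4) ^ a * (|T - x - t| ^ a - |T + x - t| ^ a)) (by linarith) ?_
    (hi.const_mul _)).trans ?_
  · filter_upwards [volume.ae_ne (T - x)] with t hne ht
    refine (abs_signedKernel_sub_le _ _ _ _ _).trans ?_
    have hlt : t < T - x := lt_of_le_of_ne ht.2 hne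
    have hle : |T + x - t| ^ a ≤ |T - x - t| ^ a := by
      refine abs_rpow_le_abs_rpow ha' (by linarith) ?_
      rw [abs_of_pos (by linarith), abs_of_pos (by linarith)]
      linarith
    rw [abs_of_nonneg (sub_nonneg.mpr hle)]
    refine mul_le_mul_of_nonneg_right ?_ (sub_nonneg.mpr hle)
    exact rpow_le_rpow_of_nonpos (by linarith) (by rw [abs_of_nonpos] <;> linarith [ht.1]) ha'.le
  · rw [intervalIntegral.integral_const_mul, intervalIntegral.integral_sub
      (intervalIntegrable_abs_sub_rpow ha _ _ _) (intervalIntegrable_abs_sub_rpow ha _ _ _),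
      integral_abs_sub_rpow_of_le_right ha (by linarith) le_rfl,
      integral_abs_sub_rpow_of_le_right ha (by linarith) (by linarith), ← sub_div, sub_self,
      zero_rpow hb.ne', div_mul_eq_mul_div]
    gcongr
    have h1 : (T - x - T / 2) ^ (a + 1) ≤ (T + x - T / 2) ^ (a + 1) :=
      rpow_le_rpow (by linarith) (by linarith) hb.le
    have h2 := rpow_le_one_add_of_le_one (x := T + x - (T - x)) (by linarith) hb.le (by linarith)
    linarith

/-- The two singular integrals cancel to order `T ^ a` when `x` and `u` are small against `T`. -/
theorem abs_integral_signedKernel_sub_le (ha : -1 < a) (ha' : a < 0) (hT : 4 ≤ T)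
    (hx : 0 ≤ x) (hxT : x ≤ T / 4) (huT : u ≤ T / 4) :
    |(∫ t in x..T, signedKernel a (x + u) T t) - ∫ t in x..T, signedKernel a u (T + x) t| ≤
      88 / (a + 1) * T ^ a * (1 + x) := by
  have hb : 0 < a + 1 := by linarith
  have hP := intervalIntegrable_signedKernel ha ha' (by linarith : u ≠ T - x)
  have hQ := intervalIntegrable_signedKernel ha ha' (by linarith : u ≠ T + x)
  have hshift : ∫ t in x..T, signedKernel a (x + u) T t =
      ∫ t in 0..(T - x), signedKernel a u (T - x) t := by
    have := intervalIntegral.integral_comp_add_right (a := 0) (b := T - x)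
      (signedKernel a (x + u) T) x
    rw [zero_add, sub_add_cancel] at this
    rw [← this]
    refine intervalIntegral.integral_congr fun t _ => ?_
    simp only [signedKernel]
    rw [show x + u - (t + x) = u - t by ring, show T - (t + x) = T - x - t by ring]
  have h1 := abs_integral_signedKernel_left_le (u := u) ha ha' hT hx hxT
  have h2 := abs_integral_signedKernel_sub_near_le (u := u) ha ha' hT hx hxT
  have h3 := abs_integral_signedKernel_sub_far_le ha ha' hT hx hxT huT
  have h4 := abs_integral_signedKernel_right_le ha ha' hT hx hxT huT
  rw [intervalIntegral.integral_sub (hP _ _) (hQ _ _)] at h2 h3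
  rw [hshift, ← intervalIntegral.integral_add_adjacent_intervals (hP 0 x) (hP x (T - x)),
    ← intervalIntegral.integral_add_adjacent_intervals (hP x (T / 2)) (hP (T / 2) (T - x)),
    ← intervalIntegral.integral_add_adjacent_intervals (hQ x (T - x)) (hQ (T - x) T),
    ← intervalIntegral.integral_add_adjacent_intervals (hQ x (T / 2)) (hQ (T / 2) (T - x))]
  have hsum : (T / 4) ^ a * (2 / (a + 1) * (1 + x)) + (T / 4) ^ a * (2 / (a + 1) * (8 * x)) +
      (T / 4) ^ a * (2 / (a + 1) * (1 + x)) + (T / 4) ^ a * (2 / (a + 1) * (1 + x)) ≤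
      88 / (a + 1) * T ^ a * (1 + x) := by
    have h5 : (T / 4) ^ a ≤ 4 * T ^ a := by
      rw [div_rpow (by linarith) (by norm_num), div_le_iff₀ (by positivity)]
      have h6 : (4:ℝ) ^ (-1 : ℝ) ≤ 4 ^ a := rpow_le_rpow_of_exponent_le (by norm_num) ha.le
      rw [rpow_neg_one] at h6
      nlinarith [rpow_nonneg (by linarith : 0 ≤ T) a]
    calc _ = (T / 4) ^ a * (2 / (a + 1) * (3 + 11 * x)) := by ring
      _ ≤ 4 * T ^ a * (2 / (a + 1) * (11 * (1 + x))) := by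
          gcongr
          linarith
      _ = _ := by ring
  refine le_trans ?_ hsum
  rw [abs_le] at *
  constructor <;> linarith [h1.1, h2.1, h3.1, h4.1, h1.2, h2.2, h3.2, h4.2]

end Interior

/-- A bound valid for all `u` off the two singular points. -/
theorem abs_integral_signedKernel_sub_le_of_ne {a T x u : ℝ} (ha : -1 < a) (ha' : a < 0)
    (hT : 1 ≤ T) (hx : 0 ≤ x) (hxT : x ≤ T) (huT : u < T) (hne : u ≠ T - x) :
    |(∫ t in x..T, signedKernel a (x + u) T t) - ∫ t in x..T, signedKernel a u (T + x) t| ≤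
      8 / (a + 1) * T * (|T - x - u| ^ a + |T - u| ^ a) := by
  have hb : 0 < a + 1 := by linarith
  have hpow : (T - x) ^ (a + 1) ≤ T := by
    calc (T - x) ^ (a + 1) ≤ T ^ (a + 1) :=
          rpow_le_rpow (by linarith) (by linarith) hb.le
      _ ≤ T ^ (1 : ℝ) := rpow_le_rpow_of_exponent_le (by linarith) (by linarith)
      _ = T := rpow_one T
  have hhalf : ∀ r s : ℝ, r ≠ 0 → |r| ≤ |s| → |s / 2| ^ a ≤ 2 * |r| ^ a := by
    intro r s hr hrs
    have h1 := abs_rpow_le_abs_rpow ha' hr hrs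
    rw [abs_div, abs_two, div_rpow (abs_nonneg _) (by norm_num), div_le_iff₀ (by positivity)]
    have h6 : (2:ℝ) ^ (-1 : ℝ) ≤ 2 ^ a := rpow_le_rpow_of_exponent_le (by norm_num) ha.le
    rw [rpow_neg_one] at h6
    nlinarith [rpow_nonneg (abs_nonneg r) a]
  have hxu : x + u ≠ T := fun h => hne (by linarith)
  have h1 := abs_integral_signedKernel_le ha ha' hxT hxu
  have h2 := abs_integral_signedKernel_le ha ha' hxT (by linarith : u ≠ T + x)
  have h3 := hhalf (T - x - u) (x + u - T) (fun h => hne (by linarith))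
    (by rw [← abs_neg, show -(T - x - u) = x + u - T by ring])
  have h4 := hhalf (T - u) (u - (T + x)) (by linarith)
    (by rw [abs_of_pos (by linarith), abs_of_neg (by linarith)]; linarith)
  have h5 : |(x + u - T) / 2| ^ a * (4 / (a + 1) * (T - x) ^ (a + 1)) ≤
      2 * |T - x - u| ^ a * (4 / (a + 1) * T) := by gcongr
  have h6 : |(u - (T + x)) / 2| ^ a * (4 / (a + 1) * (T - x) ^ (a + 1)) ≤
      2 * |T - u| ^ a * (4 / (a + 1) * T) := by gcongr
  calc _ ≤ _ := abs_sub _ _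
    _ ≤ 2 * |T - x - u| ^ a * (4 / (a + 1) * T) + 2 * |T - u| ^ a * (4 / (a + 1) * T) := by
        linarith
    _ = _ := by ring

theorem integral_exp_neg_mul_le {k : ℝ} (hk : 0 < k) (T : ℝ) :
    ∫ t in 0..T, Real.exp (-k * t) ≤ 1 / k := by
  rw [intervalIntegral.integral_comp_mul_left _ (neg_ne_zero.mpr hk.ne'), integral_exp, mul_zero,
    exp_zero, smul_eq_mul, inv_neg, neg_mul, ← mul_neg, neg_sub, one_div]
  exact mul_le_of_le_one_right (by positivity) (by linarith [exp_pos (-k * T)])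

theorem pow_four_mul_exp_neg_le {T : ℝ} (hT : 0 ≤ T) : T ^ 4 * Real.exp (-(T / 4)) ≤ 6144 := by
  have h := pow_div_factorial_le_exp (T / 4) (by positivity) 4
  rw [exp_neg, mul_inv_le_iff₀ (exp_pos _)]
  norm_num [Nat.factorial] at h
  linarith

theorem exp_mul_abs_integral_signedKernel_sub_le {a T x u : ℝ} (ha : -1 < a) (ha' : a < 0)
    (hT : 4 ≤ T) (hx : 0 ≤ x) (hxT : x ≤ T) (hu : 0 ≤ u) (huT : u < T) (hne : u ≠ T - x) :
    Real.exp (-u - x) * |(∫ t in x..T, signedKernel a (x + u) T t) -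
        ∫ t in x..T, signedKernel a u (T + x) t| ≤
      176 / (a + 1) * T ^ a * Real.exp (-(1 / 2) * x) * Real.exp (-1 * u) +
        8 / (a + 1) * T * Real.exp (-(T / 4)) * (|T - x - u| ^ a + |T - u| ^ a) := by
  have hb : 0 < a + 1 := by linarith
  by_cases h : x ≤ T / 4 ∧ u ≤ T / 4
  · have h1 := abs_integral_signedKernel_sub_le ha ha' hT hx h.1 h.2
    have h2 : 1 + x ≤ 2 * Real.exp (1 / 2 * x) := by linarith [add_one_le_exp (1 / 2 * x)]
    have h3 : Real.exp (-u - x) * Real.exp (1 / 2 * x) =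
        Real.exp (-(1 / 2) * x) * Real.exp (-1 * u) := by
      rw [← exp_add, ← exp_add]
      congr 1
      ring
    calc _ ≤ Real.exp (-u - x) * (88 / (a + 1) * T ^ a * (2 * Real.exp (1 / 2 * x))) := by
          gcongr
          exact h1.trans (by gcongr)
      _ = 176 / (a + 1) * T ^ a * (Real.exp (-u - x) * Real.exp (1 / 2 * x)) := by ring
      _ = 176 / (a + 1) * T ^ a * Real.exp (-(1 / 2) * x) * Real.exp (-1 * u) := by
          rw [h3]
          ring
      _ ≤ _ := le_add_of_nonneg_right (by positivity)
  · have h1 := abs_integral_signedKernel_sub_le_of_ne ha ha' (by linarith) hx hxT huT hne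
    have h2 : Real.exp (-u - x) ≤ Real.exp (-(T / 4)) := by
      rw [exp_le_exp]
      by_contra hlt
      exact h ⟨by linarith, by linarith⟩
    calc _ ≤ Real.exp (-(T / 4)) * (8 / (a + 1) * T * (|T - x - u| ^ a + |T - u| ^ a)) := by
          gcongr
      _ = 8 / (a + 1) * T * Real.exp (-(T / 4)) * (|T - x - u| ^ a + |T - u| ^ a) := by ring
      _ ≤ _ := le_add_of_nonneg_left (by positivity)

theorem integral_exp_mul_abs_integral_signedKernel_sub_le {a T x : ℝ} (ha : -1 < a) (ha' : a < 0)
    (hT : 4 ≤ T) (hx : 0 ≤ x) (hxT : x ≤ T) :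
    ‖∫ u in 0..T, Real.exp (-u - x) * |(∫ t in x..T, signedKernel a (x + u) T t) -
        ∫ t in x..T, signedKernel a u (T + x) t|‖ ≤
      176 / (a + 1) * T ^ a * Real.exp (-(1 / 2) * x) +
        32 / (a + 1) ^ 2 * T ^ 2 * Real.exp (-(T / 4)) := by
  have hb : 0 < a + 1 := by linarith
  have hT0 : 0 ≤ T := by linarith
  have hi1 : IntervalIntegrable (fun u : ℝ => 176 / (a + 1) * T ^ a * Real.exp (-(1 / 2) * x) *
      Real.exp (-1 * u)) volume 0 T :=
    Continuous.intervalIntegrable (by fun_prop) _ _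
  have hi2 := ((intervalIntegrable_abs_sub_rpow ha (T - x) 0 T).add
    (intervalIntegrable_abs_sub_rpow ha T 0 T)).const_mul
      (8 / (a + 1) * T * Real.exp (-(T / 4)))
  refine (intervalIntegral.norm_integral_le_of_norm_le hT0 ?_ (hi1.add hi2)).trans ?_
  · filter_upwards [volume.ae_ne T, volume.ae_ne (T - x)] with u hu hne hmem
    rw [Real.norm_eq_abs, abs_of_nonneg (by positivity)]
    exact exp_mul_abs_integral_signedKernel_sub_le ha ha' hT hx hxT hmem.1.le
      (lt_of_le_of_ne hmem.2 hu) hne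
  · rw [intervalIntegral.integral_add hi1 hi2, intervalIntegral.integral_const_mul]
    have h1 := integral_exp_neg_mul_le one_pos T
    have h2 := integral_kernel_bound_le ha ha' hT0 (T - x) T
      (8 / (a + 1) * T * Real.exp (-(T / 4))) (by positivity)
    have h3 : (T - 0) ^ (a + 1) ≤ T := by
      rw [sub_zero]
      exact (rpow_le_rpow_of_exponent_le (by linarith) (by linarith)).trans_eq (rpow_one T)
    refine add_le_add ?_ (h2.trans ?_)
    · refine mul_le_of_le_one_right (by positivity) (h1.trans_eq (by norm_num))
    · calc _ ≤ 8 / (a + 1) * T * Real.exp (-(T / 4)) * (4 / (a + 1) * T) := by gcongr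
        _ = _ := by field_simp; norm_num

theorem rpow_neg_mul_integral_signedKernel_sub_le {a T : ℝ} (ha : -1 < a) (ha' : a < 0)
    (hT : 4 ≤ T) :
    T ^ (-a) * (∫ x in 0..T, ∫ u in 0..T, Real.exp (-u - x) *
        |(∫ t in x..T, signedKernel a (x + u) T t) -
          ∫ t in x..T, signedKernel a u (T + x) t|) ≤
      352 / (a + 1) + 32 / (a + 1) ^ 2 * 6144 := by
  have hb : 0 < a + 1 := by linarith
  have hT0 : 0 < T := by linarith
  have hi : IntervalIntegrable (fun x : ℝ => 176 / (a + 1) * T ^ a * Real.exp (-(1 / 2) * x))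
      volume 0 T := Continuous.intervalIntegrable (by fun_prop) _ _
  have hmain := (le_abs_self _).trans (intervalIntegral.norm_integral_le_of_norm_le
    (f := fun x => ∫ u in 0..T, Real.exp (-u - x) *
        |(∫ t in x..T, signedKernel a (x + u) T t) -
          ∫ t in x..T, signedKernel a u (T + x) t|) hT0.le
    (Eventually.of_forall fun x hx => integral_exp_mul_abs_integral_signedKernel_sub_le ha ha' hT
      hx.1.le hx.2)
    (hi.add (intervalIntegrable_const (c := 32 / (a + 1) ^ 2 * T ^ 2 * Real.exp (-(T / 4))))))
  rw [intervalIntegral.integral_add hi intervalIntegrable_const,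
    intervalIntegral.integral_const_mul, intervalIntegral.integral_const, sub_zero,
    smul_eq_mul] at hmain
  have h1 : ∫ x in 0..T, Real.exp (-(1 / 2) * x) ≤ 2 :=
    (integral_exp_neg_mul_le one_half_pos T).trans_eq (by norm_num)
  have h2 : T ^ (-a) ≤ T :=
    (rpow_le_rpow_of_exponent_le (by linarith) (by linarith)).trans_eq (rpow_one T)
  have h3 : T ^ (-a) * T ^ a = 1 := by rw [← rpow_add hT0]; simp
  calc _ ≤ T ^ (-a) * (176 / (a + 1) * T ^ a * 2 +
        T * (32 / (a + 1) ^ 2 * T ^ 2 * Real.exp (-(T / 4)))) := by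
        gcongr
        exact hmain.trans (by gcongr)
    _ = 352 / (a + 1) * (T ^ (-a) * T ^ a) +
        32 / (a + 1) ^ 2 * (T ^ (-a) * T ^ 3 * Real.exp (-(T / 4))) := by ring
    _ ≤ 352 / (a + 1) * 1 + 32 / (a + 1) ^ 2 * (T * T ^ 3 * Real.exp (-(T / 4))) := by
        rw [h3]
        gcongr
    _ = 352 / (a + 1) + 32 / (a + 1) ^ 2 * (T ^ 4 * Real.exp (-(T / 4))) := by ring
    _ ≤ _ := by
        gcongr
        exact pow_four_mul_exp_neg_le hT0.le

theorem stmt_14 (H : ℝ) (hH : H ∈ Set.Ioo (0:ℝ) (1/2))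
    (φ5 : ℝ → ℝ → ℝ → ℝ)
    (hφ5 : ∀ T x u : ℝ, φ5 T x u =
      ∫ t in x..T, (Real.sign (x + u - t) * |x + u - t| ^ (2 * H - 1) * (T - t) ^ (2 * H - 1) -
        Real.sign (u - t) * |u - t| ^ (2 * H - 1) * (T - t + x) ^ (2 * H - 1))) :
    ∃ C : ℝ, ∀ᶠ T : ℝ in atTop,
      T ^ (1 - 2 * H) * (∫ x in (0:ℝ)..T, ∫ u in (0:ℝ)..T,
        Real.exp (-u - x) * |φ5 T x u|) ≤ C := by
  obtain ⟨hH0, hH1⟩ := hH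
  have ha : -1 < 2 * H - 1 := by linarith
  have ha' : 2 * H - 1 < 0 := by linarith
  refine ⟨352 / (2 * H - 1 + 1) + 32 / (2 * H - 1 + 1) ^ 2 * 6144, ?_⟩
  filter_upwards [eventually_ge_atTop 4] with T hT
  refine le_trans (le_of_eq ?_) (rpow_neg_mul_integral_signedKernel_sub_le ha ha' hT)
  rw [neg_sub]
  congr 1
  refine intervalIntegral.integral_congr fun x hx => ?_
  rw [Set.uIcc_of_le (by linarith)] at hx
  refine intervalIntegral.integral_congr_ae ?_
  filter_upwards [volume.ae_ne (T - x)] with u hne hu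
  rw [Set.uIoc_of_le (by linarith)] at hu
  rw [hφ5, ← intervalIntegral.integral_sub
    (intervalIntegrable_signedKernel ha ha' (fun h => hne (by linarith)) _ _)
    (intervalIntegrable_signedKernel ha ha' (fun h => hne (by linarith [hu.2, hx.1])) _ _)]
  congr 2
  refine intervalIntegral.integral_congr fun t ht => ?_
  rw [Set.uIcc_of_le hx.2] at ht
  simp only [signedKernel]
  rw [abs_of_nonneg (by linarith [ht.2] : 0 ≤ T - t),
    abs_of_nonneg (by linarith [ht.2, hx.1] : 0 ≤ T + x - t), sub_add_eq_add_sub]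
end
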